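/- Let K be a field of characteristic zero and Γ a subgroup of K^* of finite rank, and let n ≥ 3 be an integer. Define β(n) = (3n² − n)/4, and define λ(n) = 1/2 if n = 5, λ(n) = 1 if n ≡ 0 (mod 4), λ(n) = 3/2 if n ≡ 1 (mod 4) and n ≠ 5, λ(n) = 1/2 if n ≡ 2 (mod 4), λ(n) = 1 if n ≡ 3 (mod 4); μ(n) = 1 if n ≡ 0 or 3 (mod 4) and μ(n) = 1/2 if n ≡ 1 or 2 (mod 4); ν(n) = 1 if n ≡ 0 (mod 4), ν(n) = 1/2 if n ≡ 1 (mod 4), ν(n) = 3/2 if n ≡ 2 (mod 4), ν(n) = 1 if n ≡ 3 (mod 4). Then there exists a constant C > 0, depending only on n and the rank of Γ, such that for every monic polynomial f = Σ_{k=0}^{n} c_k T^k ∈ K[T] of degree n and every finite subset A of Γ of cardinality A = #A: #P_n(A; f) ≤ C·A^{β(n) − λ(n)} if c_{n−1} = c_{n−2} = 0; #P_n(A; f) ≤ C·A^{β(n) − μ(n)} if c_{n−1} = 0 and c_{n−2} ≠ 0; and #P_n(A; f) ≤ C·A^{β(n) − ν(n)} if c_{n−1} ≠ 0. -/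

import Mathlib

/-- A subgroup `Γ` of a (commutative) group has finite rank `ρ` if there is a finitely
generated subgroup `Γ₀ ≤ Γ`, generated by `ρ` elements, such that every `x ∈ Γ` has a
positive power lying in `Γ₀`. -/
def FinRank {G : Type*} [CommGroup G] (Γ : Subgroup G) (ρ : ℕ) : Prop :=
  ∃ S : Finset G, S.card = ρ ∧ (S : Set G) ⊆ (Γ : Set G) ∧
    ∀ x ∈ Γ, ∃ k : ℕ, 0 < k ∧ x ^ k ∈ Subgroup.closure (S : Set G)

/-- `β(n) = (3n² - n)/4`. -/
noncomputable def betaExp (n : ℕ) : ℝ := (3 * (n : ℝ) ^ 2 - n) / 4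

/-- `λ(n)` from Theorem B.1. -/
noncomputable def lamExp (n : ℕ) : ℝ :=
  if n = 5 then 1 / 2
  else if n % 4 = 0 then 1
  else if n % 4 = 1 then 3 / 2
  else if n % 4 = 2 then 1 / 2
  else 1

/-- `μ(n)` from Theorem B.1. -/
noncomputable def muExp (n : ℕ) : ℝ :=
  if n % 4 = 0 ∨ n % 4 = 3 then 1 else 1 / 2

/-- `ν(n)` from Theorem B.1. -/
noncomputable def nuExp (n : ℕ) : ℝ :=
  if n % 4 = 0 then 1
  else if n % 4 = 1 then 1 / 2
  else if n % 4 = 2 then 3 / 2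
  else 1

section ZeroSums

variable {G : Type*} [AddCommGroup G] [DecidableEq G]

/-- The sum of `∏ i, g i (x i)` over all tuples `x` of elements of `A` with `∑ i, x i = 0`. -/
noncomputable def zeroSum {ι : Type*} [Fintype ι] [DecidableEq ι] (A : Finset G)
    (g : ι → G → ℝ) : ℝ :=
  ∑ x ∈ (Fintype.piFinset fun _ : ι => A) with ∑ i, x i = 0, ∏ i, g i (x i)

/-- The element of the group algebra with coefficients `f` on `A`. -/
noncomputable def algElem (A : Finset G) (f : G → ℝ) : AddMonoidAlgebra ℝ G :=
  ∑ a ∈ A, AddMonoidAlgebra.single a (f a)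

lemma zeroSum_eq_coeff {ι : Type*} [Fintype ι] [DecidableEq ι] (A : Finset G) (g : ι → G → ℝ) :
    zeroSum A g = (∏ i, algElem A (g i)).coeff 0 := by
  unfold zeroSum algElem
  rw [Finset.prod_univ_sum, AddMonoidAlgebra.coeff_sum, Finsupp.finsetSum_apply,
    Finset.sum_filter]
  refine Finset.sum_congr rfl fun x _ => ?_
  rw [AddMonoidAlgebra.prod_single, AddMonoidAlgebra.coeff_single, Finsupp.single_apply]

/-- The ring endomorphism of the group algebra induced by negation. -/
noncomputable def negRingHom : AddMonoidAlgebra ℝ G →+* AddMonoidAlgebra ℝ G :=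
  AddMonoidAlgebra.mapDomainRingHom ℝ (negAddMonoidHom : G →+ G)

omit [DecidableEq G] in
lemma negRingHom_algElem {A : Finset G} (hA : ∀ a ∈ A, -a ∈ A) {f : G → ℝ}
    (hf : ∀ x, f (-x) = f x) : negRingHom (algElem A f) = algElem A f := by
  unfold negRingHom algElem
  rw [map_sum]
  refine Finset.sum_nbij' (fun a => -a) (fun a => -a) hA hA ?_ ?_ ?_ <;> simp [hf]

lemma coeff_mul_self_nonneg {F : AddMonoidAlgebra ℝ G} (hF : negRingHom F = F) :
    0 ≤ (F * F).coeff 0 := by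
  have hsymm : ∀ x, F.coeff (-x) = F.coeff x := by
    intro x
    have h1 : (negRingHom F).coeff (-x) = F.coeff x := by
      have := Finsupp.mapDomain_apply (f := (fun a : G => -a)) neg_injective F.coeff x
      simpa [negRingHom] using this
    rw [← h1, hF]
  rw [AddMonoidAlgebra.coeff_mul]
  refine Finset.sum_nonneg fun a _ => Finset.sum_nonneg fun b _ => ?_
  dsimp only
  split_ifs with h
  · rw [eq_neg_of_add_eq_zero_left h, hsymm]
    exact mul_self_nonneg _
  · exact le_rfl

lemma coeff_mul_sq_le {F H : AddMonoidAlgebra ℝ G} (hF : negRingHom F = F)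
    (hH : negRingHom H = H) :
    ((F * H).coeff 0) ^ 2 ≤ (F * F).coeff 0 * (H * H).coeff 0 := by
  have key : ∀ t : ℝ,
      0 ≤ (H * H).coeff 0 * (t * t) + (2 * (F * H).coeff 0) * t + (F * F).coeff 0 := by
    intro t
    have h1 : negRingHom (F + AddMonoidAlgebra.single 0 t * H) =
        F + AddMonoidAlgebra.single 0 t * H := by
      rw [map_add, map_mul, hF, hH]
      simp [negRingHom]
    have h2 := coeff_mul_self_nonneg h1
    have h3 : (F + AddMonoidAlgebra.single 0 t * H) * (F + AddMonoidAlgebra.single 0 t * H) =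
        F * F + t • ((2 : ℝ) • (F * H)) + (t * t) • (H * H) := by
      have h4 : AddMonoidAlgebra.single (0 : G) t = algebraMap ℝ _ t := rfl
      rw [h4]
      simp only [Algebra.smul_def, map_mul, map_ofNat]
      ring
    rw [h3] at h2
    simp only [AddMonoidAlgebra.coeff_add, AddMonoidAlgebra.coeff_smul, Finsupp.add_apply,
      Finsupp.smul_apply, smul_eq_mul] at h2
    linarith
  have := discrim_le_zero key
  unfold discrim at this
  nlinarith

lemma coeff_prod_pow_le (s : ℕ) : ∀ F : ℕ → AddMonoidAlgebra ℝ G,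
    (∀ i, negRingHom (F i) = F i) →
    ((∏ i ∈ Finset.range (2 ^ s), F i).coeff 0) ^ 2 ^ s ≤
      ∏ i ∈ Finset.range (2 ^ s), (F i ^ 2 ^ s).coeff 0 := by
  induction s with
  | zero => intro F _; simp
  | succ s ih =>
    intro F hF
    have hprod : ∀ F : ℕ → AddMonoidAlgebra ℝ G, (∀ i, negRingHom (F i) = F i) →
        negRingHom (∏ i ∈ Finset.range (2 ^ s), F i) = ∏ i ∈ Finset.range (2 ^ s), F i := by
      intro F hF
      rw [map_prod]
      exact Finset.prod_congr rfl fun i _ => hF i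
    have hsq : ∀ F : ℕ → AddMonoidAlgebra ℝ G, (∀ i, negRingHom (F i) = F i) →
        (((∏ i ∈ Finset.range (2 ^ s), F i) * ∏ i ∈ Finset.range (2 ^ s), F i).coeff 0) ^ 2 ^ s
          ≤ ∏ i ∈ Finset.range (2 ^ s), (F i ^ 2 ^ (s + 1)).coeff 0 := by
      intro F hF
      rw [← Finset.prod_mul_distrib]
      refine (ih (fun i => F i * F i) fun i => by rw [map_mul, hF]).trans (le_of_eq ?_)
      refine Finset.prod_congr rfl fun i _ => ?_
      rw [← pow_two, ← pow_mul, pow_succ' 2 s]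
    have hF' : ∀ i, negRingHom (F (2 ^ s + i)) = F (2 ^ s + i) := fun i => hF _
    have hcs := coeff_mul_sq_le (hprod F hF) (hprod _ hF')
    have h0 := coeff_mul_self_nonneg (hprod F hF)
    have h0' := coeff_mul_self_nonneg (hprod _ hF')
    rw [show 2 ^ (s + 1) = 2 ^ s + 2 ^ s by ring, Finset.prod_range_add, Finset.prod_range_add,
      ← show 2 ^ (s + 1) = 2 ^ s + 2 ^ s by ring]
    calc _ = ((((∏ i ∈ Finset.range (2 ^ s), F i) *
              ∏ i ∈ Finset.range (2 ^ s), F (2 ^ s + i)).coeff 0) ^ 2) ^ 2 ^ s := by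
            rw [← pow_mul, pow_succ' 2 s]
      _ ≤ _ := pow_le_pow_left₀ (sq_nonneg _) hcs _
      _ = _ := mul_pow _ _ _
      _ ≤ _ := mul_le_mul (hsq F hF) (hsq _ hF') (pow_nonneg h0' _) ((pow_nonneg h0 _).trans
            (hsq F hF))

lemma zeroSum_nonneg {ι : Type*} [Fintype ι] [DecidableEq ι] (A : Finset G) {g : ι → G → ℝ}
    (hg : ∀ i x, 0 ≤ g i x) : 0 ≤ zeroSum A g :=
  Finset.sum_nonneg fun _ _ => Finset.prod_nonneg fun i _ => hg i _

/-- The normalized `2 ^ s`-fold zero sum of `f`. -/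
noncomputable def zeroNorm (s : ℕ) (A : Finset G) (f : G → ℝ) : ℝ :=
  (zeroSum A fun _ : Fin (2 ^ s) => f) ^ ((2 ^ s : ℕ) : ℝ)⁻¹

lemma zeroNorm_nonneg (s : ℕ) (A : Finset G) {f : G → ℝ} (hf : ∀ x, 0 ≤ f x) :
    0 ≤ zeroNorm s A f :=
  Real.rpow_nonneg (zeroSum_nonneg A fun _ => hf) _

lemma zeroNorm_pow (s : ℕ) (A : Finset G) {f : G → ℝ} (hf : ∀ x, 0 ≤ f x) :
    zeroNorm s A f ^ 2 ^ s = zeroSum A fun _ : Fin (2 ^ s) => f :=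
  Real.rpow_inv_natCast_pow (zeroSum_nonneg A fun _ => hf) (by positivity)

lemma zeroSum_le_prod_zeroNorm (s : ℕ) {A : Finset G} (hA : ∀ a ∈ A, -a ∈ A)
    {g : Fin (2 ^ s) → G → ℝ} (hg : ∀ i x, 0 ≤ g i x) (hg' : ∀ i x, g i (-x) = g i x) :
    zeroSum A g ≤ ∏ i, zeroNorm s A (g i) := by
  refine le_of_pow_le_pow_left₀ (n := 2 ^ s) (by positivity)
    (Finset.prod_nonneg fun i _ => zeroNorm_nonneg s A (hg i)) ?_
  rw [← Finset.prod_pow]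
  simp only [zeroNorm_pow s A (hg _), zeroSum_eq_coeff, Finset.prod_const, Finset.card_univ,
    Fintype.card_fin]
  let F : ℕ → AddMonoidAlgebra ℝ G := fun i => if h : i < 2 ^ s then algElem A (g ⟨i, h⟩) else 1
  have hF : ∀ i : Fin (2 ^ s), F i = algElem A (g i) := fun i => by simp [F]
  have := coeff_prod_pow_le s F fun i => by
    by_cases h : i < 2 ^ s
    · simp only [F, h, dif_pos]
      exact negRingHom_algElem hA (hg' _)
    · simp [F, h]
  rw [Finset.prod_range, Finset.prod_range] at this
  simpa only [hF] using this

/-- If every zero sum of elements of the support of `f` contains two terms at different places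
whose `κ`-values are near each other, then `zeroNorm` satisfies a square function estimate for
the decomposition of `f` along `κ`. -/
lemma zeroNorm_sq_le_sum {κ : Type*} [DecidableEq κ] {s : ℕ} (hs : 1 ≤ s) {A : Finset G}
    (hA : ∀ a ∈ A, -a ∈ A) {f : G → ℝ} (hf : ∀ x, 0 ≤ f x) (hf' : ∀ x, f (-x) = f x)
    (c : G → κ) (hc : ∀ x, c (-x) = c x) (R : κ → κ → Prop) [DecidableRel R]
    (hR : ∀ i j, R i j → R j i) (D : ℕ)
    (hD : ∀ i, ((A.image c).filter (R i)).card ≤ D)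
    (hpair : ∀ x : Fin (2 ^ s) → G, (∀ i, x i ∈ A) → (∀ i, f (x i) ≠ 0) → ∑ i, x i = 0 →
      ∃ i j, i ≠ j ∧ R (c (x i)) (c (x j))) :
    zeroNorm s A f ^ 2 ≤ ((2 ^ s) ^ 2 * D : ℝ) *
      ∑ u ∈ A.image c, zeroNorm s A (fun x => if c x = u then f x else 0) ^ 2 := by
  set I := A.image c
  set p : κ → G → ℝ := fun u x => if c x = u then f x else 0 with hp
  have hp0 : ∀ u x, 0 ≤ p u x := fun u x => by simp only [hp]; split_ifs <;> simp [hf]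
  have hp' : ∀ u x, p u (-x) = p u x := fun u x => by simp [hp, hc, hf']
  set N := zeroNorm s A f
  set n : κ → ℝ := fun u => zeroNorm s A (p u)
  have hN : 0 ≤ N := zeroNorm_nonneg s A hf
  have hn : ∀ u, 0 ≤ n u := fun u => zeroNorm_nonneg s A (hp0 u)
  let g : Fin (2 ^ s) → Fin (2 ^ s) → κ → κ → Fin (2 ^ s) → G → ℝ := fun a b u v i =>
    if i = a then p u else if i = b then p v else f
  have hg0 : ∀ a b u v i x, 0 ≤ g a b u v i x := by
    intro a b u v i x; simp only [g]; split_ifs <;> simp [hp0, hf]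
  have hg' : ∀ a b u v i x, g a b u v i (-x) = g a b u v i x := by
    intro a b u v i x; simp only [g]; split_ifs <;> simp [hp', hf']
  set Q : Finset (Fin (2 ^ s) × Fin (2 ^ s)) := Finset.univ.filter fun q => q.1 ≠ q.2
  set W : Finset (κ × κ) := (I ×ˢ I).filter fun w => R w.1 w.2
  have h2s : 2 ≤ 2 ^ s := by
    calc 2 = 2 ^ 1 := rfl
      _ ≤ 2 ^ s := Nat.pow_le_pow_right (by norm_num) hs
  have step1 : N ^ 2 ^ s ≤ ∑ q ∈ Q, ∑ w ∈ W, zeroSum A (g q.1 q.2 w.1 w.2) := by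
    rw [zeroNorm_pow s A hf]
    simp only [zeroSum]
    rw [Finset.sum_congr rfl fun q _ => Finset.sum_comm, Finset.sum_comm]
    refine Finset.sum_le_sum fun x hx => ?_
    simp only [Finset.mem_filter, Fintype.mem_piFinset] at hx
    by_cases h : ∀ i, f (x i) ≠ 0
    · obtain ⟨a, b, hab, hRab⟩ := hpair x hx.1 h hx.2
      have h1 : ∏ i, f (x i) = ∏ i, g a b (c (x a)) (c (x b)) i (x i) := by
        refine Finset.prod_congr rfl fun i _ => ?_
        simp only [g]
        split_ifs with h1 h2
        · subst h1; simp [hp]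
        · subst h2; simp [hp]
        · rfl
      rw [h1]
      have hW : (c (x a), c (x b)) ∈ W := by
        simp only [W, Finset.mem_filter, Finset.mem_product, I]
        exact ⟨⟨Finset.mem_image_of_mem _ (hx.1 a), Finset.mem_image_of_mem _ (hx.1 b)⟩, hRab⟩
      have hQ : (a, b) ∈ Q := by simp [Q, hab]
      refine le_trans ?_ (Finset.single_le_sum (f := fun q : Fin (2 ^ s) × Fin (2 ^ s) =>
        ∑ w ∈ W, ∏ i, g q.1 q.2 w.1 w.2 i (x i)) (fun q _ => Finset.sum_nonneg fun w _ =>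
          Finset.prod_nonneg fun i _ => hg0 _ _ _ _ _ _) hQ)
      exact Finset.single_le_sum (f := fun w : κ × κ => ∏ i, g a b w.1 w.2 i (x i))
        (fun w _ => Finset.prod_nonneg fun i _ => hg0 _ _ _ _ _ _) hW
    · push Not at h
      obtain ⟨i, hi⟩ := h
      rw [Finset.prod_eq_zero (Finset.mem_univ i) hi]
      exact Finset.sum_nonneg fun q _ => Finset.sum_nonneg fun w _ =>
          Finset.prod_nonneg fun i _ => hg0 _ _ _ _ _ _
  have step2 : ∀ q ∈ Q, ∀ w ∈ W, zeroSum A (g q.1 q.2 w.1 w.2) ≤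
      n w.1 * n w.2 * N ^ (2 ^ s - 2) := by
    intro q hq w _
    have hq' : q.2 ≠ q.1 := by simpa [Q, eq_comm] using hq
    refine (zeroSum_le_prod_zeroNorm s hA (hg0 _ _ _ _) (hg' _ _ _ _)).trans (le_of_eq ?_)
    rw [← Finset.mul_prod_erase _ _ (Finset.mem_univ q.1),
      ← Finset.mul_prod_erase _ _ (Finset.mem_erase.2 ⟨hq', Finset.mem_univ q.2⟩), ← mul_assoc]
    have e1 : g q.1 q.2 w.1 w.2 q.1 = p w.1 := by simp [g]
    have e2 : g q.1 q.2 w.1 w.2 q.2 = p w.2 := by simp [g, hq']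
    rw [e1, e2]
    congr 1
    rw [Finset.prod_congr rfl (g := fun _ => N), Finset.prod_const,
      Finset.card_erase_of_mem (Finset.mem_erase.2 ⟨hq', Finset.mem_univ q.2⟩),
      Finset.card_erase_of_mem (Finset.mem_univ _), Finset.card_univ, Fintype.card_fin]
    · rfl
    · intro i hi
      simp only [Finset.mem_erase] at hi
      simp [g, hi.1, hi.2.1, N]
  have step3 : ∑ w ∈ W, n w.1 * n w.2 ≤ D * ∑ u ∈ I, n u ^ 2 := by
    have h1 : ∑ w ∈ W, n w.1 ^ 2 ≤ D * ∑ u ∈ I, n u ^ 2 := by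
      simp only [W]
      rw [Finset.sum_filter, Finset.sum_product, Finset.mul_sum]
      refine Finset.sum_le_sum fun u _ => ?_
      dsimp only
      rw [← Finset.sum_filter, Finset.sum_const, nsmul_eq_mul]
      exact mul_le_mul_of_nonneg_right (by exact_mod_cast hD u) (sq_nonneg _)
    have h2 : ∑ w ∈ W, n w.2 ^ 2 = ∑ w ∈ W, n w.1 ^ 2 := by
      refine Finset.sum_nbij' Prod.swap Prod.swap ?_ ?_ ?_ ?_ ?_ <;>
        simp +contextual [W] <;> intros <;> apply hR <;> assumption
    have h3 : ∑ w ∈ W, n w.1 * n w.2 ≤ ∑ w ∈ W, (n w.1 ^ 2 + n w.2 ^ 2) / 2 :=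
      Finset.sum_le_sum fun w _ => by nlinarith [sq_nonneg (n w.1 - n w.2)]
    rw [← Finset.sum_div, Finset.sum_add_distrib, h2] at h3
    linarith
  have step4 : N ^ 2 ^ s ≤ ((2 ^ s) ^ 2 * D * ∑ u ∈ I, n u ^ 2) * N ^ (2 ^ s - 2) := by
    refine step1.trans ((Finset.sum_le_sum fun q hq =>
      Finset.sum_le_sum (step2 q hq)).trans ?_)
    rw [Finset.sum_const, nsmul_eq_mul, ← Finset.sum_mul, ← mul_assoc]
    refine mul_le_mul_of_nonneg_right ?_ (pow_nonneg hN _)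
    rw [mul_assoc ((2 ^ s : ℝ) ^ 2)]
    have hQcard : (Q.card : ℝ) ≤ (2 ^ s) ^ 2 := by
      have : Q.card ≤ 2 ^ s * 2 ^ s := by
        refine (Finset.card_le_univ Q).trans ?_
        simp
      rw [pow_two]
      exact_mod_cast this
    exact mul_le_mul hQcard step3 (Finset.sum_nonneg fun w _ => mul_nonneg (hn _) (hn _))
      (by positivity)
  rcases hN.eq_or_lt with h0 | hpos
  · rw [← h0]
    simp only [ne_eq, OfNat.ofNat_ne_zero, not_false_eq_true, zero_pow]
    exact mul_nonneg (by positivity) (Finset.sum_nonneg fun u _ => sq_nonneg _)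
  · refine le_of_mul_le_mul_right ?_ (pow_pos hpos (2 ^ s - 2))
    rw [← pow_add, Nat.add_sub_cancel' h2s]
    exact step4

end ZeroSums

section DivHull

/-- The group of all elements having a positive power in the subgroup generated by `S`. -/
def divHull {G : Type*} [CommGroup G] {ι : Type*} (S : ι → G) : Subgroup G where
  carrier := {u | ∃ m : ℕ, 0 < m ∧ u ^ m ∈ Subgroup.closure (Set.range S)}
  one_mem' := ⟨1, one_pos, by simp⟩
  mul_mem' := by
    rintro a b ⟨m, hm, ha⟩ ⟨l, hl, hb⟩
    refine ⟨m * l, Nat.mul_pos hm hl, ?_⟩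
    rw [mul_pow, pow_mul, mul_comm m l, pow_mul]
    exact mul_mem (pow_mem ha _) (pow_mem hb _)
  inv_mem' := by
    rintro a ⟨m, hm, ha⟩
    exact ⟨m, hm, by rw [inv_pow]; exact inv_mem ha⟩

lemma mem_divHull {G : Type*} [CommGroup G] {ι : Type*} {S : ι → G} {u : G} :
    u ∈ divHull S ↔ ∃ m : ℕ, 0 < m ∧ u ^ m ∈ Subgroup.closure (Set.range S) := Iff.rfl

lemma map_mem_divHull {G H : Type*} [CommGroup G] [CommGroup H] {ι : Type*} {S : ι → G}
    (φ : G →* H) {u : G} (hu : u ∈ divHull S) : φ u ∈ divHull (fun i => φ (S i)) := by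
  obtain ⟨m, hm, h⟩ := hu
  refine ⟨m, hm, ?_⟩
  have h2 := Subgroup.mem_map_of_mem φ h
  rw [MonoidHom.map_closure, ← Set.range_comp, map_pow] at h2
  exact h2

lemma exists_coeff_of_mem_divHull {G J ι : Type*} [CommGroup G] [Fintype ι] {S : ι → G}
    {l : J → G → ℝ} (hl : ∀ j x y, l j (x * y) = l j x + l j y) {u : G} (hu : u ∈ divHull S) :
    ∃ q : ι → ℝ, ∀ j, l j u = ∑ i, l j (S i) * q i := by
  classical
  have h1 : ∀ j, l j 1 = 0 := fun j => by have := hl j 1 1; rw [mul_one] at this; linarith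
  have hinv : ∀ j x, l j x⁻¹ = - l j x := fun j x => by
    have := hl j x x⁻¹; rw [mul_inv_cancel, h1] at this; linarith
  have hpow : ∀ j x (m : ℕ), l j (x ^ m) = m * l j x := fun j x m => by
    induction m with
    | zero => simp [h1]
    | succ m ih => rw [pow_succ, hl, ih]; push_cast; ring
  obtain ⟨m, hm, h⟩ := hu
  have key : ∃ q : ι → ℝ, ∀ j, l j (u ^ m) = ∑ i, l j (S i) * q i := by
    generalize u ^ m = w at h ⊢
    induction h using Subgroup.closure_induction with
    | mem x hx =>
      obtain ⟨i, rfl⟩ := hx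
      exact ⟨Pi.single i 1, fun j => by simp [Pi.single_apply]⟩
    | one => exact ⟨0, fun j => by simp [h1]⟩
    | mul x y _ _ hx hy =>
      obtain ⟨q, hq⟩ := hx
      obtain ⟨q', hq'⟩ := hy
      exact ⟨q + q', fun j => by simp [hl, hq, hq', mul_add, Finset.sum_add_distrib]⟩
    | inv x _ hx =>
      obtain ⟨q, hq⟩ := hx
      exact ⟨-q, fun j => by simp [hinv, hq]⟩
  obtain ⟨q, hq⟩ := key
  have hm' : (m : ℝ) ≠ 0 := by positivity
  refine ⟨fun i => q i / m, fun j => ?_⟩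
  have := hq j
  rw [hpow] at this
  rw [eq_div_of_mul_eq hm' ((mul_comm _ _).trans this), Finset.sum_div]
  exact Finset.sum_congr rfl fun i _ => by ring

/-- Among finitely many linear forms on `ℝ ^ ρ`, some `ρ` of them control all the others. -/
lemma exists_controlling_forms {J : Type*} [DecidableEq J] : ∀ (ρ : ℕ) (v : J → Fin ρ → ℝ)
    (T : Finset J), (∀ j ∉ T, v j = 0) → ∃ t : Finset J, t.card ≤ ρ ∧
      ∀ (z : Fin ρ → ℝ) (ε : ℝ), 0 ≤ ε → (∀ i ∈ t, |∑ s, v i s * z s| ≤ ε) →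
        ∀ j, |∑ s, v j s * z s| ≤ 3 ^ ρ * ε := by
  intro ρ
  induction ρ with
  | zero => intro v T _; exact ⟨∅, by simp, fun z ε hε _ j => by simpa using hε⟩
  | succ ρ ih =>
    intro v T hT
    rcases T.eq_empty_or_nonempty with rfl | hne
    · refine ⟨∅, by simp, fun z ε hε _ j => ?_⟩
      rw [hT j (by simp)]
      simp only [Pi.zero_apply, zero_mul, Finset.sum_const_zero, abs_zero]
      positivity
    obtain ⟨i, -, hi⟩ := Finset.exists_max_image T (fun j => |v j 0|) hne
    have hi' : ∀ j, |v j 0| ≤ |v i 0| := fun j => by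
      by_cases hj : j ∈ T
      · exact hi j hj
      · rw [hT j hj]; simp
    set c : J → ℝ := fun j => v j 0 / v i 0 with hc
    have hc0 : ∀ j, v j 0 = c j * v i 0 := fun j => by
      by_cases h0 : v i 0 = 0
      · have := hi' j
        rw [h0, abs_zero, abs_nonpos_iff] at this
        rw [this, h0, mul_zero]
      · rw [hc, div_mul_cancel₀ _ h0]
    have hc1 : ∀ j, |c j| ≤ 1 := fun j => by
      rw [hc, abs_div]; exact div_le_one_of_le₀ (hi' j) (abs_nonneg _)
    obtain ⟨t, ht, h⟩ := ih (fun j s => v j s.succ - c j * v i s.succ) T (fun j hj => by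
      ext s; simp [hT j hj, hc])
    have key : ∀ (z : Fin (ρ + 1) → ℝ) j, ∑ s, v j s * z s =
        ∑ s : Fin ρ, (v j s.succ - c j * v i s.succ) * z s.succ + c j * ∑ s, v i s * z s := by
      intro z j
      rw [Fin.sum_univ_succ, Fin.sum_univ_succ (fun s => v i s * z s), mul_add, Finset.mul_sum,
        hc0 j]
      simp only [sub_mul, Finset.sum_sub_distrib, mul_assoc]
      ring
    refine ⟨insert i t, (Finset.card_insert_le _ _).trans (by omega), fun z ε hε hz j => ?_⟩
    have hci : ∀ j, |c j * ∑ s, v i s * z s| ≤ ε := fun j => by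
      rw [abs_mul]
      calc _ ≤ 1 * ε := mul_le_mul (hc1 j) (hz i (Finset.mem_insert_self _ _)) (abs_nonneg _)
            zero_le_one
        _ = ε := one_mul _
    have h2 := h (fun s => z s.succ) (2 * ε) (by positivity) (fun a ha => by
      have h3 := hz a (Finset.mem_insert_of_mem ha)
      have h4 := hci a
      rw [key z a] at h3
      rw [abs_le] at *
      constructor <;> linarith [h3.1, h3.2, h4.1, h4.2]) j
    rw [key z j]
    have h5 : (1 : ℝ) ≤ 3 ^ ρ := one_le_pow₀ (by norm_num)
    calc _ ≤ 3 ^ ρ * (2 * ε) + ε := (abs_add_le _ _).trans (add_le_add h2 (hci j))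
      _ ≤ 3 ^ ρ * (2 * ε) + 3 ^ ρ * ε := by nlinarith
      _ = _ := by ring

end DivHull

section Cells

variable {G : Type*} [AddCommGroup G] [DecidableEq G]

lemma zeroNorm_sq_le_of_cells {J : Type*} [DecidableEq J] {s : ℕ} (hs : 1 ≤ s) {A : Finset G}
    (hA : ∀ a ∈ A, -a ∈ A) {f : G → ℝ} (hf : ∀ x, 0 ≤ f x) (hf' : ∀ x, f (-x) = f x)
    {l : J → G → ℝ} (hl : ∀ j x, l j (-x) = l j x) {η d : ℝ} (hη : 0 < η)
    (hpair : ∀ j, ∀ x : Fin (2 ^ s) → G, (∀ i, x i ∈ A) → ∑ i, x i = 0 →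
      ∃ a b, a ≠ b ∧ |l j (x a) - l j (x b)| ≤ d) {B : ℝ} (t : Finset J) :
    ∀ P : Set G, (∀ x ∈ P, -x ∈ P) →
    (∀ V : Set G, V ⊆ P → (∀ x ∈ V, -x ∈ V) →
      (∀ x ∈ V, ∀ y ∈ V, ∀ i ∈ t, |l i x - l i y| ≤ η) →
      zeroNorm s A (V.indicator f) ^ 2 ≤ B * ∑ a ∈ A, V.indicator f a ^ 2) →
    zeroNorm s A (P.indicator f) ^ 2 ≤
      ((2 ^ s) ^ 2 * (2 * ⌈d / η⌉₊ + 3 : ℕ)) ^ t.card * B * ∑ a ∈ A, P.indicator f a ^ 2 := by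
  classical
  induction t using Finset.induction_on with
  | empty =>
    intro P hP h
    have := h P subset_rfl hP (by simp)
    simpa using this
  | insert i t hit ih =>
    intro P hP h
    set N : ℕ := ⌈d / η⌉₊ + 1 with hN
    set c : G → ℤ := fun x => ⌊l i x / η⌋ with hc
    have hcneg : ∀ x, c (-x) = c x := fun x => by simp only [hc, hl]
    have hind : ∀ V : Set G, (∀ x ∈ V, -x ∈ V) → ∀ x, V.indicator f (-x) = V.indicator f x := by
      intro V hV x
      have : -x ∈ V ↔ x ∈ V := ⟨fun h => by simpa using hV _ h, hV x⟩
      simp [Set.indicator_apply, this, hf']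
    have hnn : ∀ V : Set G, ∀ x, 0 ≤ V.indicator f x := fun V x =>
      Set.indicator_nonneg (fun _ _ => hf _) x
    have h1 := zeroNorm_sq_le_sum hs hA (hnn P) (hind P hP) c hcneg
      (fun a b => |a - b| ≤ (N : ℤ)) (fun a b hab => by rwa [abs_sub_comm]) (2 * N + 1)
      (fun a => by
        refine (Finset.card_le_card (t := Finset.Icc (a - N) (a + N)) ?_).trans ?_
        · intro b hb
          have := (Finset.mem_filter.1 hb).2
          rw [abs_le] at this
          rw [Finset.mem_Icc]
          constructor <;> omega
        · rw [Int.card_Icc]; omega)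
      (fun x hx _ hsum => by
        obtain ⟨a, b, hab, h3⟩ := hpair i x hx hsum
        refine ⟨a, b, hab, ?_⟩
        have h4 : |l i (x a) / η - l i (x b) / η| ≤ ⌈d / η⌉₊ := by
          rw [← sub_div, abs_div, abs_of_pos hη]
          exact (div_le_div_of_nonneg_right h3 hη.le).trans (Nat.le_ceil _)
        have h5 := Int.floor_le (l i (x a) / η)
        have h6 := Int.lt_floor_add_one (l i (x a) / η)
        have h7 := Int.floor_le (l i (x b) / η)
        have h8 := Int.lt_floor_add_one (l i (x b) / η)
        rw [abs_le] at h4 ⊢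
        have h9 : (c (x a) : ℝ) - c (x b) < ((⌈d / η⌉₊ : ℤ) : ℝ) + 1 := by
          push_cast; simp only [hc]; linarith
        have h10 : -((⌈d / η⌉₊ : ℤ) : ℝ) - 1 < (c (x a) : ℝ) - c (x b) := by
          push_cast; simp only [hc]; linarith
        norm_cast at h9 h10
        rw [hN]; push_cast
        constructor <;> omega)
    have h2 : ∀ u, (fun x => if c x = u then P.indicator f x else 0) =
        (P ∩ {x | c x = u}).indicator f := by
      intro u; ext x
      by_cases h : c x = u <;> by_cases h' : x ∈ P <;> simp [h, h']
    simp only [h2] at h1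
    set E : ℝ := (2 ^ s) ^ 2 * (2 * ⌈d / η⌉₊ + 3 : ℕ) with hE
    have hE0 : 0 ≤ E := by positivity
    have h3 : ∀ u, zeroNorm s A ((P ∩ {x | c x = u}).indicator f) ^ 2 ≤
        E ^ t.card * B * ∑ a ∈ A, (P ∩ {x | c x = u}).indicator f a ^ 2 := by
      intro u
      refine ih _ (fun x hx => ⟨hP x hx.1, (hcneg x).trans hx.2⟩) fun V hV hV' hV'' =>
        h V (hV.trans Set.inter_subset_left) hV' fun x hx y hy j hj => ?_
      rcases Finset.mem_insert.1 hj with rfl | hj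
      · have hx1 : ⌊l j x / η⌋ = ⌊l j y / η⌋ := (hV hx).2.trans (hV hy).2.symm
        have := Int.abs_sub_lt_one_of_floor_eq_floor hx1
        rw [← sub_div, abs_div, abs_of_pos hη, div_lt_one hη] at this
        exact this.le
      · exact hV'' x hx y hy j hj
    have h4 : ∑ u ∈ A.image c, ∑ a ∈ A, (P ∩ {x | c x = u}).indicator f a ^ 2 =
        ∑ a ∈ A, P.indicator f a ^ 2 := by
      rw [Finset.sum_comm]
      refine Finset.sum_congr rfl fun a ha => ?_
      rw [Finset.sum_eq_single (c a)]
      · by_cases h' : a ∈ P <;> simp [h']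
      · intro u _ hu
        simp [hu.symm]
      · intro hn; exact absurd (Finset.mem_image_of_mem c ha) hn
    calc _ ≤ _ := h1
      _ ≤ ((2 ^ s) ^ 2 * (2 * N + 1 : ℕ) : ℝ) * ∑ u ∈ A.image c, E ^ t.card * B *
          ∑ a ∈ A, (P ∩ {x | c x = u}).indicator f a ^ 2 :=
        mul_le_mul_of_nonneg_left (Finset.sum_le_sum fun u _ => h3 u) (by positivity)
      _ = _ := by
        rw [← Finset.mul_sum, h4, Finset.card_insert_of_notMem hit, hN, pow_succ E]
        have : (2 * (⌈d / η⌉₊ + 1) + 1 : ℕ) = 2 * ⌈d / η⌉₊ + 3 := by ring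
        rw [this, ← hE]; ring

lemma zeroNorm_le_sum (s : ℕ) (A : Finset G) {f : G → ℝ} (hf : ∀ x, 0 ≤ f x) :
    zeroNorm s A f ≤ ∑ a ∈ A, f a := by
  have h0 : 0 ≤ ∑ a ∈ A, f a := Finset.sum_nonneg fun a _ => hf a
  refine le_of_pow_le_pow_left₀ (n := 2 ^ s) (by positivity) h0 ?_
  rw [zeroNorm_pow s A hf, zeroSum]
  calc _ ≤ ∑ x ∈ Fintype.piFinset fun _ : Fin (2 ^ s) => A, ∏ i, f (x i) :=
        Finset.sum_le_sum_of_subset_of_nonneg (Finset.filter_subset _ _)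
          fun x _ _ => Finset.prod_nonneg fun i _ => hf _
    _ = _ := by
      rw [Finset.sum_prod_piFinset A (fun _ => f)]; simp

end Cells

section Rigidity

open NumberField IsDedekindDomain

lemma dvd_sum_pow_prime {R : Type*} [CommRing R] {p : ℕ} (hp : p.Prime) {ι : Type*}
    (t : Finset ι) (z : ι → R) : (p : R) ∣ (∑ i ∈ t, z i) ^ p - ∑ i ∈ t, z i ^ p := by
  classical
  induction t using Finset.induction_on with
  | empty => simp [hp.ne_zero]
  | insert i t hi ih =>
    rw [Finset.sum_insert hi, Finset.sum_insert hi]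
    obtain ⟨r, hr⟩ := exists_add_pow_prime_eq hp (z i) (∑ j ∈ t, z j)
    obtain ⟨q, hq⟩ := ih
    exact ⟨z i * (∑ j ∈ t, z j) * r + q, by rw [hr]; linear_combination hq⟩

variable {L : Type*} [Field L] [NumberField L]

lemma eq_zero_of_forall_infinitePlace_lt_one {a : 𝓞 L}
    (h : ∀ w : InfinitePlace L, w (a : L) < 1) : a = 0 := by
  by_contra ha
  obtain ⟨w⟩ : Nonempty (InfinitePlace L) := inferInstance
  exact (InfinitePlace.one_le_of_lt_one ha (w := w) fun z _ => h z).not_gt (h w)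

lemma sum_pow_eq_zero {k : ℕ} {z : Fin k → 𝓞 L} (hsum : ∑ i, z i = 0) {E : ℕ}
    (hE : ∀ (w : InfinitePlace L) i, w (z i : L) ^ E ≤ 2) :
    ∀ e : ℕ, 1 ≤ e → e ≤ E → e.Coprime (2 * k).factorial → ∑ i, z i ^ e = 0 := by
  intro e
  induction e using Nat.strong_induction_on with
  | _ e ih =>
    intro he1 heE hcop
    rcases he1.eq_or_lt with rfl | he
    · simpa using hsum
    obtain ⟨p, hp, e', rfl⟩ := Nat.exists_prime_and_dvd he.ne'
    have he' : 1 ≤ e' := Nat.pos_of_ne_zero (by rintro rfl; simp at he1)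
    have hpk : 2 * k < p := by
      by_contra! hle
      exact hp.one_lt.ne' (Nat.Coprime.eq_one_of_dvd (Nat.Coprime.coprime_mul_right hcop)
        (Nat.dvd_factorial hp.pos hle))
    have h0 := ih e' (lt_mul_of_one_lt_left he' hp.one_lt) he'
      ((Nat.le_mul_of_pos_left _ hp.pos).trans heE) (Nat.Coprime.coprime_mul_left hcop)
    obtain ⟨q, hq⟩ := dvd_sum_pow_prime hp Finset.univ (fun i => z i ^ e')
    rw [h0, zero_pow hp.ne_zero, zero_sub] at hq
    simp only [← pow_mul] at hq
    rw [mul_comm p e']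
    suffices hq0 : q = 0 by rw [hq0, mul_zero, neg_eq_zero] at hq; exact hq
    refine eq_zero_of_forall_infinitePlace_lt_one fun w => ?_
    have hp0 : (0 : ℝ) < p := by exact_mod_cast hp.pos
    have h1 : w ((p : L) * q) ≤ k * 2 := by
      have : (p : L) * q = -∑ i, (z i : L) ^ (e' * p) := by
        have := congrArg (algebraMap (𝓞 L) L) hq
        simp only [map_neg, map_sum, map_pow, map_mul, map_natCast] at this
        exact this.symm
      rw [this, ← InfinitePlace.norm_embedding_eq w, map_neg, norm_neg, map_sum]
      refine (norm_sum_le _ _).trans ?_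
      calc _ ≤ ∑ _i : Fin k, (2 : ℝ) := Finset.sum_le_sum fun i _ => by
            rw [InfinitePlace.norm_embedding_eq w, map_pow, mul_comm e' p]
            have hn : 0 ≤ w (z i : L) := apply_nonneg w _
            rcases le_or_gt (w (z i : L)) 1 with h | h
            · exact (pow_le_one₀ hn h).trans (by norm_num)
            · exact (pow_le_pow_right₀ h.le heE).trans (hE w i)
        _ = _ := by simp
    rw [map_mul, ← InfinitePlace.norm_embedding_eq w (p : L), map_natCast, Complex.norm_natCast]
      at h1
    have h2 : ((2 * k : ℕ) : ℝ) < p := by exact_mod_cast hpk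
    push_cast at h2
    by_contra! h3
    nlinarith

lemma exists_pow_eq_pow {k : ℕ} (hk : 1 ≤ k) {z : Fin k → 𝓞 L} (hz : ∀ i, z i ≠ 0)
    (hsum : ∑ i, z i = 0)
    (hE : ∀ (w : InfinitePlace L) i, w (z i : L) ^ (1 + k * (2 * k).factorial) ≤ 2) :
    ∃ a b, a ≠ b ∧ z a ^ (2 * k).factorial = z b ^ (2 * k).factorial := by
  by_contra! hcon
  set M := (2 * k).factorial
  have hinj : Function.Injective fun i => z i ^ M := fun a b hab => by
    by_contra hne; exact hcon a b hne hab
  have := Matrix.eq_zero_of_forall_pow_sum_mul_pow_eq_zero hinj (v := z) fun i => by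
    have h := sum_pow_eq_zero hsum hE (1 + i * M) (by omega)
      (by have := Nat.mul_le_mul_right M i.2.le; omega) (by rw [Nat.coprime_add_mul_right_left]; exact Nat.coprime_one_left _)
    rw [← h]
    exact Finset.sum_congr rfl fun j _ => by rw [pow_add, pow_one, ← pow_mul, mul_comm M]
  exact hz ⟨0, hk⟩ (congrFun this _)

/-- The logarithms of all the normalized absolute values of a number field. -/
noncomputable def placeLog (L : Type*) [Field L] [NumberField L]
    (j : InfinitePlace L ⊕ HeightOneSpectrum (𝓞 L)) (x : L) : ℝ :=
  Sum.elim (fun w => Real.log (w x)) (fun v => ((WithZero.log (v.valuation L x) : ℤ) : ℝ)) j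

lemma placeLog_mul (j) {x y : L} (hx : x ≠ 0) (hy : y ≠ 0) :
    placeLog L j (x * y) = placeLog L j x + placeLog L j y := by
  rcases j with w | v
  · simp only [placeLog, Sum.elim_inl, map_mul]
    exact Real.log_mul (by simpa using hx) (by simpa using hy)
  · simp only [placeLog, Sum.elim_inr, map_mul]
    rw [WithZero.log_mul (by simpa using hx) (by simpa using hy)]
    push_cast; rfl

lemma placeLog_neg (j) (x : L) : placeLog L j (-x) = placeLog L j x := by
  rcases j with w | v
  · simp only [placeLog, Sum.elim_inl]
    rw [← InfinitePlace.norm_embedding_eq w, map_neg, norm_neg, InfinitePlace.norm_embedding_eq w]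
  · simp only [placeLog, Sum.elim_inr, Valuation.map_neg]

lemma exists_placeLog_sub_le (j) {k : ℕ} (hk : 2 ≤ k) {x : Fin k → L} (hx : ∀ i, x i ≠ 0)
    (hsum : ∑ i, x i = 0) :
    ∃ a b, a ≠ b ∧ |placeLog L j (x a) - placeLog L j (x b)| ≤ Real.log k := by
  classical
  have hne : (Finset.univ : Finset (Fin k)).Nonempty := ⟨⟨0, by omega⟩, Finset.mem_univ _⟩
  have hlog : 0 ≤ Real.log k := Real.log_natCast_nonneg k
  rcases j with w | v
  · simp only [placeLog, Sum.elim_inl]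
    obtain ⟨a, -, ha⟩ := Finset.exists_max_image Finset.univ (fun i => w (x i)) hne
    have hne' : (Finset.univ.erase a).Nonempty := by
      rw [← Finset.card_pos, Finset.card_erase_of_mem (Finset.mem_univ _), Finset.card_univ,
        Fintype.card_fin]
      omega
    obtain ⟨b, hb, hb'⟩ := Finset.exists_max_image _ (fun i => w (x i)) hne'
    have h1 : x a = -∑ i ∈ Finset.univ.erase a, x i := by
      rw [← Finset.add_sum_erase _ _ (Finset.mem_univ a)] at hsum
      exact eq_neg_of_add_eq_zero_left hsum
    have hpos : ∀ i, 0 < w (x i) := fun i => InfinitePlace.pos_iff.2 (hx i)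
    have h2 : w (x a) ≤ k * w (x b) := by
      nth_rw 1 [h1]
      rw [← InfinitePlace.norm_embedding_eq w, map_neg, norm_neg, map_sum]
      refine (norm_sum_le _ _).trans ?_
      calc _ ≤ ∑ i ∈ Finset.univ.erase a, w (x b) := Finset.sum_le_sum fun i hi => by
            rw [InfinitePlace.norm_embedding_eq w]; exact hb' i hi
        _ ≤ _ := by
          rw [Finset.sum_const, nsmul_eq_mul]
          refine mul_le_mul_of_nonneg_right ?_ (hpos b).le
          exact_mod_cast (Finset.card_le_univ _).trans (by simp)
    refine ⟨a, b, (Finset.ne_of_mem_erase hb).symm, ?_⟩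
    have h3 := Real.log_le_log (hpos a) h2
    rw [Real.log_mul (by positivity) (hpos b).ne'] at h3
    have h4 := Real.log_le_log (hpos b) (ha b (Finset.mem_univ _))
    rw [abs_le]
    constructor <;> linarith
  · simp only [placeLog, Sum.elim_inr]
    obtain ⟨a, -, ha⟩ := Finset.exists_max_image Finset.univ (fun i => v.valuation L (x i)) hne
    have h1 : x a = -∑ i ∈ Finset.univ.erase a, x i := by
      rw [← Finset.add_sum_erase _ _ (Finset.mem_univ a)] at hsum
      exact eq_neg_of_add_eq_zero_left hsum
    by_contra! hcon
    have hlt : ∀ i ∈ Finset.univ.erase a, v.valuation L (x i) < v.valuation L (x a) := by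
      intro i hi
      refine lt_of_le_of_ne (ha i (Finset.mem_univ _)) fun heq => ?_
      have := hcon a i (Finset.ne_of_mem_erase hi).symm
      rw [heq, sub_self, abs_zero] at this
      exact this.not_ge hlog
    have h2 := (v.valuation L).map_sum_lt (by simpa using hx a) hlt
    rw [← Valuation.map_neg, ← h1] at h2
    exact h2.false

lemma finite_placeLog_ne_zero {x : L} (hx : x ≠ 0) : {j | placeLog L j x ≠ 0}.Finite := by
  have h1 := HeightOneSpectrum.Support.finite (𝓞 L) x
  have h2 := HeightOneSpectrum.Support.finite (𝓞 L) x⁻¹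
  refine ((Set.finite_range (Sum.inl : InfinitePlace L → _)).union
    ((h1.union h2).image Sum.inr)).subset ?_
  rintro (w | v) hj
  · exact Or.inl ⟨w, rfl⟩
  · refine Or.inr ⟨v, ?_, rfl⟩
    simp only [placeLog, Sum.elim_inr, Set.mem_ofPred_eq] at hj
    rcases lt_trichotomy (v.valuation L x) 1 with h | h | h
    · right
      change 1 < v.valuation L x⁻¹
      rw [map_inv₀]
      exact (one_lt_inv₀ (zero_lt_iff.2 (by simpa using hx))).2 h
    · rw [h] at hj; simp at hj
    · exact Or.inl h

lemma exists_pow_eq_pow_of_placeLog {k : ℕ} (hk : 1 ≤ k) {x : Fin k → L} (hx : ∀ i, x i ≠ 0)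
    (hsum : ∑ i, x i = 0)
    (hE : ∀ j a b, |placeLog L j (x a) - placeLog L j (x b)| ≤
      Real.log 2 / (1 + k * (2 * k).factorial : ℕ)) :
    ∃ a b, a ≠ b ∧ x a ^ (2 * k).factorial = x b ^ (2 * k).factorial := by
  set E := 1 + k * (2 * k).factorial with hEdef
  have hE0 : (0 : ℝ) < E := by rw [hEdef]; positivity
  set o : Fin k := ⟨0, hk⟩
  have hlog2 : Real.log 2 < 1 := by linarith [Real.log_two_lt_d9]
  have h1 : ∀ i, ∃ z : 𝓞 L, (z : L) = x i / x o := by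
    intro i
    refine HeightOneSpectrum.mem_integers_of_valuation_le_one L _ fun v => ?_
    have h2 := hE (Sum.inr v) i o
    have hvi : v.valuation L (x i) ≠ 0 := by simpa using hx i
    have hvo : v.valuation L (x o) ≠ 0 := by simpa using hx o
    have h3 : Real.log 2 / (E : ℕ) < 1 := by
      rw [div_lt_one hE0]
      refine hlog2.trans_le ?_
      rw [hEdef]; push_cast
      have : (0 : ℝ) ≤ k * (2 * k).factorial := by positivity
      linarith
    have h4 := h2.trans_lt h3
    simp only [placeLog, Sum.elim_inr] at h4
    have h5 : WithZero.log (v.valuation L (x i)) - WithZero.log (v.valuation L (x o)) = 0 :=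
      Int.abs_lt_one_iff.1 (by exact_mod_cast h4)
    rw [map_div₀, ← WithZero.exp_log hvi, sub_eq_zero.1 h5, WithZero.exp_log hvo, div_self hvo]
  choose z hz using h1
  obtain ⟨a, b, hab, h⟩ := exists_pow_eq_pow hk (z := z)
    (fun i hi => by
      have := hz i
      rw [hi] at this
      exact div_ne_zero (hx i) (hx o) (by simpa using this.symm))
    (by
      have : algebraMap (𝓞 L) L (∑ i, z i) = 0 := by
        rw [map_sum]
        calc _ = ∑ i, x i / x o := Finset.sum_congr rfl fun i _ => hz i
          _ = 0 := by rw [← Finset.sum_div, hsum, zero_div]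
      exact (map_eq_zero_iff _ (FaithfulSMul.algebraMap_injective (𝓞 L) L)).1 this)
    (fun w i => by
      have hw : ∀ i, 0 < w (x i) := fun i => InfinitePlace.pos_iff.2 (hx i)
      have h2 := (abs_le.1 (hE (Sum.inl w) i o)).2
      simp only [placeLog, Sum.elim_inl] at h2
      rw [hz i, map_div₀, ← Real.log_le_log_iff (pow_pos (div_pos (hw _) (hw _)) _) two_pos,
        Real.log_pow, Real.log_div (hw _).ne' (hw _).ne']
      rwa [le_div_iff₀ hE0, mul_comm] at h2)
  refine ⟨a, b, hab, ?_⟩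
  have h' := congrArg (algebraMap (𝓞 L) L) h
  rw [map_pow, map_pow] at h'
  change (z a : L) ^ _ = (z b : L) ^ _ at h'
  rw [hz, hz, div_pow, div_pow] at h'
  exact (div_left_inj' (pow_ne_zero _ (hx o))).1 h'

end Rigidity

section NumberFieldBound

open NumberField IsDedekindDomain

lemma sum_image_ite {G κ : Type*} [DecidableEq κ] (A : Finset G) (c : G → κ) (f : G → ℝ) :
    ∑ u ∈ A.image c, ∑ a ∈ A, (if c a = u then f a else 0) ^ 2 = ∑ a ∈ A, f a ^ 2 := by
  rw [Finset.sum_comm]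
  refine Finset.sum_congr rfl fun a ha => ?_
  rw [Finset.sum_eq_single (c a)]
  · simp
  · intro u _ hu
    simp [hu.symm]
  · intro hn; exact absurd (Finset.mem_image_of_mem c ha) hn

lemma card_filter_pow_eq_le {L : Type*} [Field L] [DecidableEq L] (A : Finset L) {M : ℕ}
    (hM : 0 < M) (u : L) : (A.filter fun x => x ^ M = u).card ≤ M := by
  refine (Finset.card_le_card fun x hx => ?_).trans
    ((Multiset.toFinset_card_le (Polynomial.nthRoots M u)).trans (Polynomial.card_nthRoots M u))
  rw [Multiset.mem_toFinset, Polynomial.mem_nthRoots hM]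
  exact (Finset.mem_filter.1 hx).2

lemma zeroNorm_sq_le_of_pow_pair {L : Type*} [Field L] [DecidableEq L] {s : ℕ} (hs : 1 ≤ s)
    {A : Finset L} (hA : ∀ a ∈ A, -a ∈ A) {f : L → ℝ} (hf : ∀ x, 0 ≤ f x)
    (hf' : ∀ x, f (-x) = f x) {M : ℕ} (hM : 0 < M) (hM' : Even M)
    (hpair : ∀ x : Fin (2 ^ s) → L, (∀ i, x i ∈ A) → (∀ i, f (x i) ≠ 0) → ∑ i, x i = 0 →
      ∃ a b, a ≠ b ∧ x a ^ M = x b ^ M) :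
    zeroNorm s A f ^ 2 ≤ (2 ^ s) ^ 2 * M * ∑ a ∈ A, f a ^ 2 := by
  have h1 := zeroNorm_sq_le_sum hs hA hf hf' (fun x => x ^ M) (fun x => hM'.neg_pow x)
    (· = ·) (fun a b h => h.symm) 1 (fun a => Finset.card_le_one.2 (by simp_all)) hpair
  have h2 : ∀ u, zeroNorm s A (fun x => if x ^ M = u then f x else 0) ^ 2 ≤
      M * ∑ a ∈ A, (if a ^ M = u then f a else 0) ^ 2 := by
    intro u
    have hnn : ∀ x, 0 ≤ (if x ^ M = u then f x else 0) := fun x => by split_ifs <;> simp [hf]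
    calc _ ≤ (∑ a ∈ A, if a ^ M = u then f a else 0) ^ 2 :=
          pow_le_pow_left₀ (zeroNorm_nonneg _ _ hnn) (zeroNorm_le_sum _ _ hnn) 2
      _ = (∑ a ∈ A with a ^ M = u, f a) ^ 2 := by rw [Finset.sum_filter]
      _ ≤ _ := sq_sum_le_card_mul_sum_sq
      _ ≤ M * ∑ a ∈ A with a ^ M = u, f a ^ 2 :=
          mul_le_mul_of_nonneg_right (by exact_mod_cast card_filter_pow_eq_le A hM u)
            (Finset.sum_nonneg fun _ _ => sq_nonneg _)
      _ = _ := by rw [Finset.sum_filter]; simp [ite_pow]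
  calc _ ≤ _ := h1
    _ ≤ (2 ^ s) ^ 2 * (1 : ℕ) * ∑ u ∈ A.image (fun x => x ^ M),
        M * ∑ a ∈ A, (if a ^ M = u then f a else 0) ^ 2 :=
      mul_le_mul_of_nonneg_left (Finset.sum_le_sum fun u _ => h2 u) (by positivity)
    _ = _ := by rw [← Finset.mul_sum, sum_image_ite]; push_cast; ring

lemma exists_zeroNorm_sq_le_numberField {s : ℕ} (hs : 1 ≤ s) (ρ : ℕ) :
    ∃ C : ℝ, 0 ≤ C ∧ ∀ (L : Type*) [Field L] [NumberField L] [DecidableEq L] (S : Fin ρ → Lˣ)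
      (A : Finset L), (∀ a ∈ A, ∃ u ∈ divHull S, (u : L) = a) → (∀ a ∈ A, -a ∈ A) →
      ∀ f : L → ℝ, (∀ x, 0 ≤ f x) → (∀ x, f (-x) = f x) →
        zeroNorm s A f ^ 2 ≤ C * ∑ a ∈ A, f a ^ 2 := by
  classical
  set M := (2 * 2 ^ s).factorial with hMdef
  set δ : ℝ := Real.log 2 / (1 + 2 ^ s * M : ℕ) with hδ
  have hδ0 : 0 < δ := div_pos (Real.log_pos one_lt_two) (by positivity)
  set η : ℝ := δ / 3 ^ ρ with hη
  have hη0 : 0 < η := by positivity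
  set E : ℝ := (2 ^ s) ^ 2 * (2 * ⌈Real.log (2 ^ s : ℕ) / η⌉₊ + 3 : ℕ) with hE
  have hE1 : 1 ≤ E := by
    have h1 : (1 : ℝ) ≤ (2 ^ s) ^ 2 := one_le_pow₀ (one_le_pow₀ one_le_two)
    have h2 : (1 : ℝ) ≤ (2 * ⌈Real.log (2 ^ s : ℕ) / η⌉₊ + 3 : ℕ) := by
      exact_mod_cast (by omega : 1 ≤ 2 * ⌈Real.log (2 ^ s : ℕ) / η⌉₊ + 3)
    rw [hE]
    exact one_le_mul_of_one_le_of_one_le h1 h2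
  refine ⟨E ^ ρ * ((2 ^ s) ^ 2 * M), by positivity, ?_⟩
  intro L _ _ _ S A hA hsym f hf hf'
  have hA0 : ∀ a ∈ A, a ≠ 0 := fun a ha => by
    obtain ⟨u, -, rfl⟩ := hA a ha
    exact u.ne_zero
  have hk2 : 2 ≤ 2 ^ s := by calc 2 = 2 ^ 1 := rfl
      _ ≤ 2 ^ s := Nat.pow_le_pow_right two_pos hs
  have hfin : (⋃ i, {j | placeLog L j (S i : L) ≠ 0}).Finite :=
    Set.finite_iUnion fun i => finite_placeLog_ne_zero (S i).ne_zero
  obtain ⟨t, ht, hctrl⟩ := exists_controlling_forms ρ (fun j i => placeLog L j (S i : L))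
    hfin.toFinset (fun j hj => by
      ext i
      by_contra hne
      exact hj (hfin.mem_toFinset.2 (Set.mem_iUnion.2 ⟨i, hne⟩)))
  have key : ∀ x ∈ A, ∀ y ∈ A, (∀ i ∈ t, |placeLog L i x - placeLog L i y| ≤ η) →
      ∀ j, |placeLog L j x - placeLog L j y| ≤ δ := by
    intro x hx y hy hxy
    obtain ⟨u, hu, rfl⟩ := hA x hx
    obtain ⟨v, hv, rfl⟩ := hA y hy
    obtain ⟨q, hq⟩ := exists_coeff_of_mem_divHull (l := fun j (u : Lˣ) => placeLog L j (u : L))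
      (fun j x y => by rw [Units.val_mul]; exact placeLog_mul j x.ne_zero y.ne_zero)
      (div_mem hu hv)
    have hdiv : ∀ j, placeLog L j u - placeLog L j v = ∑ i, placeLog L j (S i) * q i := by
      intro j
      rw [← hq j, sub_eq_iff_eq_add, ← placeLog_mul j (u / v).ne_zero v.ne_zero,
        ← Units.val_mul, div_mul_cancel]
    intro j
    rw [hdiv j]
    have := hctrl q η hη0.le (fun i hi => by rw [← hdiv i]; exact hxy i hi) j
    rwa [hη, mul_div_cancel₀ _ (by positivity : (3 : ℝ) ^ ρ ≠ 0)] at this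
  have hmain := zeroNorm_sq_le_of_cells hs hsym hf hf' (l := placeLog L) placeLog_neg hη0
    (d := Real.log (2 ^ s : ℕ)) (B := (2 ^ s) ^ 2 * M)
    (fun j x hx hsum => exists_placeLog_sub_le j hk2 (fun i => hA0 _ (hx i)) hsum) t Set.univ
    (by simp) (fun V _ hVneg hV => by
      refine zeroNorm_sq_le_of_pow_pair hs hsym (fun x => Set.indicator_nonneg (fun _ _ => hf _) x)
        (fun x => ?_) (Nat.factorial_pos _) (even_iff_two_dvd.2 ?_) ?_
      · have : -x ∈ V ↔ x ∈ V := ⟨fun h => by simpa using hVneg _ h, hVneg x⟩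
        simp [Set.indicator_apply, this, hf']
      · exact Nat.dvd_factorial two_pos (by omega)
      · intro x hxA hxV hsum
        have hxV' : ∀ i, x i ∈ V := fun i => Set.mem_of_indicator_ne_zero (hxV i)
        exact exists_pow_eq_pow_of_placeLog (by omega) (fun i => hA0 _ (hxA i)) hsum
          fun j a b => key _ (hxA a) _ (hxA b) (hV _ (hxV' a) _ (hxV' b)) j)
  rw [Set.indicator_univ] at hmain
  refine hmain.trans (mul_le_mul_of_nonneg_right (mul_le_mul_of_nonneg_right
    (pow_le_pow_right₀ hE1 ht) (by positivity)) (Finset.sum_nonneg fun _ _ => sq_nonneg _))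

end NumberFieldBound

section Specialization

universe u

lemma exists_ringHom_numberField (R : Type u) [CommRing R] [Nontrivial R] [Algebra ℚ R]
    [Algebra.FiniteType ℚ R] :
    ∃ (L : Type u) (_ : Field L) (_ : NumberField L), Nonempty (R →+* L) := by
  obtain ⟨m, hm⟩ := Ideal.exists_maximal R
  let _ : Field (R ⧸ m) := Ideal.Quotient.field m
  have hfin : Module.Finite ℚ (R ⧸ m) := finite_of_finite_type_of_isJacobsonRing ℚ (R ⧸ m)
  have hchar : CharZero (R ⧸ m) := algebraRat.charZero _
  refine ⟨R ⧸ m, inferInstance, @NumberField.mk _ _ hchar ?_, ⟨Ideal.Quotient.mk m⟩⟩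
  convert hfin
  exact Subsingleton.elim _ _

lemma exists_specialization (K : Type u) [Field K] [CharZero K] (F : Finset K) :
    ∃ (R : Subalgebra ℚ K) (L : Type u) (_ : Field L) (_ : NumberField L) (_ : R →+* L),
      ∀ x ∈ F, x ∈ R := by
  have hfg : Algebra.FiniteType ℚ (Algebra.adjoin ℚ (F : Set K)) :=
    (Subalgebra.fg_iff_finiteType _).1 ⟨F, rfl⟩
  obtain ⟨L, hL, hL', ⟨φ⟩⟩ := exists_ringHom_numberField (Algebra.adjoin ℚ (F : Set K))
  exact ⟨_, L, hL, hL', φ, fun x hx => Algebra.subset_adjoin hx⟩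

lemma zeroNorm_le_of_specialization {K L : Type*} [Field K] [Field L] [DecidableEq K]
    [DecidableEq L] {R : Subring K} (φ : R →+* L) (s : ℕ) {A : Finset K} (hA : ∀ a ∈ A, a ∈ R)
    {Φ : K → L} (hΦ : ∀ x : R, Φ x = φ x) (hinj : Set.InjOn Φ A) {f : K → ℝ} {g : L → ℝ}
    (hf : ∀ x, 0 ≤ f x) (hg : ∀ x, 0 ≤ g x) (hfg : ∀ a ∈ A, g (Φ a) = f a) :
    zeroNorm s A f ≤ zeroNorm s (A.image Φ) g := by
  refine le_of_pow_le_pow_left₀ (n := 2 ^ s) (by positivity) (zeroNorm_nonneg _ _ hg) ?_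
  rw [zeroNorm_pow s A hf, zeroNorm_pow s _ hg, zeroSum, zeroSum]
  set F := (Fintype.piFinset fun _ : Fin (2 ^ s) => A).filter fun x => ∑ i, x i = 0 with hF
  have hmem : ∀ x ∈ F, ∀ i, x i ∈ A := fun x hx => Fintype.mem_piFinset.1 (Finset.mem_filter.1 hx).1
  calc _ = ∑ x ∈ F, ∏ i, g ((fun i => Φ (x i)) i) :=
        Finset.sum_congr rfl fun x hx => Finset.prod_congr rfl fun i _ => (hfg _ (hmem x hx i)).symm
    _ = ∑ y ∈ F.image (fun x i => Φ (x i)), ∏ i, g (y i) := by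
        rw [Finset.sum_image]
        intro x hx y hy hxy
        exact funext fun i => hinj (hmem x hx i) (hmem y hy i) (congrFun hxy i)
    _ ≤ _ := by
        refine Finset.sum_le_sum_of_subset_of_nonneg (fun y hy => ?_)
          fun _ _ _ => Finset.prod_nonneg fun _ _ => hg _
        obtain ⟨x, hx, rfl⟩ := Finset.mem_image.1 hy
        refine Finset.mem_filter.2 ⟨Fintype.mem_piFinset.2 fun i =>
          Finset.mem_image_of_mem _ (hmem x hx i), ?_⟩
        have h1 := (Finset.mem_filter.1 hx).2
        have h2 : φ (∑ i, ⟨x i, hA _ (hmem x hx i)⟩) = 0 := by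
          rw [← map_zero φ]
          congr 1
          ext
          simpa using h1
        rw [map_sum] at h2
        rw [← h2]
        exact Finset.sum_congr rfl fun i _ => hΦ ⟨x i, hA _ (hmem x hx i)⟩

lemma mem_divHull_of_injective {G H : Type*} [CommGroup G] [CommGroup H] {ι : Type*} {S : ι → G}
    {φ : G →* H} (hφ : Function.Injective φ) {u : G} (hu : φ u ∈ divHull (fun i => φ (S i))) :
    u ∈ divHull S := by
  obtain ⟨m, hm, h⟩ := hu
  refine ⟨m, hm, ?_⟩
  have : Set.range (fun i => φ (S i)) = φ '' Set.range S := by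
    rw [← Set.range_comp]; rfl
  rw [this, ← MonoidHom.map_closure, ← map_pow] at h
  obtain ⟨w, hw, hw'⟩ := h
  rwa [← hφ hw']

lemma exists_zeroNorm_sq_le {s : ℕ} (hs : 1 ≤ s) (ρ : ℕ) :
    ∃ C : ℝ, 0 ≤ C ∧ ∀ (K : Type u) [Field K] [CharZero K] [DecidableEq K] (S : Fin ρ → Kˣ)
      (A : Finset K), (∀ a ∈ A, ∃ u ∈ divHull S, (u : K) = a) → (∀ a ∈ A, -a ∈ A) →
      ∀ f : K → ℝ, (∀ x, 0 ≤ f x) → (∀ x, f (-x) = f x) →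
        zeroNorm s A f ^ 2 ≤ C * ∑ a ∈ A, f a ^ 2 := by
  classical
  obtain ⟨C, hC, h⟩ := exists_zeroNorm_sq_le_numberField.{u} hs ρ
  refine ⟨C, hC, ?_⟩
  intro K _ _ _ S A hA hsym f hf hf'
  set T : Finset K := Finset.univ.image fun i => (S i : K) with hT
  obtain ⟨R, L, _, _, φ, hR⟩ := exists_specialization K
    (A ∪ A.image (·⁻¹) ∪ T ∪ T.image (·⁻¹) ∪ (A ×ˢ A).image fun p => (p.1 - p.2)⁻¹)
  have hRA : ∀ a ∈ A, a ∈ R := fun a ha => hR _ (by simp [ha])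
  have hRA' : ∀ a ∈ A, a⁻¹ ∈ R := fun a ha => hR _ (by simp [ha])
  have hRT : ∀ i, (S i : K) ∈ R := fun i => hR _ (by simp [hT])
  have hRT' : ∀ i, ((S i)⁻¹ : K) ∈ R := fun i => hR _ (by simp [hT])
  have hRsub : ∀ a ∈ A, ∀ b ∈ A, (a - b)⁻¹ ∈ R := fun a ha b hb => hR _ (by
    simp only [Finset.mem_union, Finset.mem_image, Finset.mem_product]
    exact Or.inr ⟨(a, b), ⟨ha, hb⟩, rfl⟩)
  set Φ : K → L := fun x => if hx : x ∈ R then φ ⟨x, hx⟩ else 0 with hΦdef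
  have hΦ : ∀ x : R, Φ x = φ x := fun x => by simp [hΦdef]
  have hinj : Set.InjOn Φ A := by
    intro a ha b hb hab
    by_contra hne
    have h1 : φ (⟨a, hRA a ha⟩ - ⟨b, hRA b hb⟩) = 0 := by
      rw [map_sub, ← hΦ, ← hΦ, sub_eq_zero]; exact hab
    have h2 : (⟨a, hRA a ha⟩ - ⟨b, hRA b hb⟩ : R) * ⟨(a - b)⁻¹, hRsub a ha b hb⟩ = 1 := by
      ext
      exact mul_inv_cancel₀ (sub_ne_zero.2 hne)
    have h3 := congrArg φ h2
    rw [map_mul, h1, zero_mul, map_one] at h3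
    exact zero_ne_one h3
  have hΦneg : ∀ a ∈ A, Φ (-a) = -Φ a := fun a ha => by
    have h1 := hΦ (-⟨a, hRA a ha⟩)
    rw [map_neg, ← hΦ] at h1
    exact h1
  set S' : Fin ρ → Rˣ := fun i => ⟨⟨S i, hRT i⟩, ⟨(S i)⁻¹, hRT' i⟩, by ext; simp, by ext; simp⟩
    with hS'
  have hinjU : Function.Injective (Units.map (R.val : R →* K)) :=
    Units.map_injective Subtype.val_injective
  have hSS' : (fun i => Units.map (R.val : R →* K) (S' i)) = S := by
    ext i; rfl
  have hΦA : ∀ b ∈ A.image Φ, ∃ u ∈ divHull (fun i => Units.map (φ : R →* L) (S' i)),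
      (u : L) = b := by
    intro b hb
    obtain ⟨a, ha, rfl⟩ := Finset.mem_image.1 hb
    obtain ⟨u, hu, rfl⟩ := hA a ha
    set u' : Rˣ := ⟨⟨u, hRA _ ha⟩, ⟨(u : K)⁻¹, hRA' _ ha⟩, by ext; simp, by ext; simp⟩ with hu'
    have h1 : Units.map (R.val : R →* K) u' = u := by ext; rfl
    have h2 : u' ∈ divHull S' := mem_divHull_of_injective hinjU (by rw [hSS', h1]; exact hu)
    refine ⟨_, map_mem_divHull (Units.map (φ : R →* L)) h2, ?_⟩
    exact (hΦ ⟨u, hRA _ ha⟩).symm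
  set g : L → ℝ := fun y => ∑ a ∈ A with Φ a = y, f a with hg
  have hgf : ∀ a ∈ A, g (Φ a) = f a := by
    intro a ha
    simp only [hg]
    rw [Finset.sum_eq_single a]
    · intro b hb hba
      exact absurd (hinj (Finset.mem_filter.1 hb).1 ha (Finset.mem_filter.1 hb).2) hba
    · intro hn; exact absurd ha (by simpa using hn)
  have hgneg : ∀ y, g (-y) = g y := by
    intro y
    refine Finset.sum_bij (fun a _ => -a) ?_ ?_ ?_ ?_
    · intro a ha
      obtain ⟨ha, hay⟩ := Finset.mem_filter.1 ha
      exact Finset.mem_filter.2 ⟨hsym a ha, by rw [hΦneg a ha, hay, neg_neg]⟩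
    · intro a _ b _ hab; exact neg_injective hab
    · intro b hb
      obtain ⟨hb, hby⟩ := Finset.mem_filter.1 hb
      exact ⟨-b, Finset.mem_filter.2 ⟨hsym b hb, by rw [hΦneg b hb, hby]⟩, neg_neg b⟩
    · intro a _; exact (hf' a).symm
  have hg0 : ∀ y, 0 ≤ g y := fun y => Finset.sum_nonneg fun a _ => hf a
  have hle := zeroNorm_le_of_specialization (R := R.toSubring) φ s hRA hΦ hinj hf hg0 hgf
  have hb := h L (fun i => Units.map (φ : R →* L) (S' i)) (A.image Φ) hΦA (by
    intro b hb
    obtain ⟨a, ha, rfl⟩ := Finset.mem_image.1 hb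
    rw [← hΦneg a ha]
    exact Finset.mem_image_of_mem _ (hsym a ha)) g hg0 hgneg
  calc _ ≤ _ := pow_le_pow_left₀ (zeroNorm_nonneg _ _ hf) hle 2
    _ ≤ _ := hb
    _ = _ := by
      rw [Finset.sum_image hinj]
      congr 1
      exact Finset.sum_congr rfl fun a ha => by rw [hgf a ha]

end Specialization

section LinearEquation

universe u

/-- The sum of `v` restricted to `B` and its reflection. -/
noncomputable def symmExt {G : Type*} [Neg G] (B : Set G) (v : G → ℝ) (x : G) : ℝ :=
  B.indicator v x + B.indicator v (-x)

lemma symmExt_nonneg {G : Type*} [Neg G] {B : Set G} {v : G → ℝ} (hv : ∀ x, 0 ≤ v x) (x : G) :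
    0 ≤ symmExt B v x :=
  add_nonneg (Set.indicator_nonneg (fun _ _ => hv _) _) (Set.indicator_nonneg (fun _ _ => hv _) _)

lemma symmExt_neg {G : Type*} [AddCommGroup G] (B : Set G) (v : G → ℝ) (x : G) :
    symmExt B v (-x) = symmExt B v x := by
  rw [symmExt, symmExt, neg_neg, add_comm]

lemma le_symmExt {G : Type*} [Neg G] {B : Set G} {v : G → ℝ} (hv : ∀ x, 0 ≤ v x) {x : G}
    (hx : x ∈ B) : v x ≤ symmExt B v x := by
  rw [symmExt, Set.indicator_of_mem hx]
  exact le_add_of_nonneg_right (Set.indicator_nonneg (fun _ _ => hv _) _)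

lemma sum_symmExt_sq_le {G : Type*} [AddCommGroup G] {A B : Finset G}
    (hA : ∀ a ∈ A, -a ∈ A) (hB : B ⊆ A) (v : G → ℝ) :
    ∑ a ∈ A, symmExt (B : Set G) v a ^ 2 ≤ 4 * ∑ b ∈ B, v b ^ 2 := by
  classical
  have h1 : ∑ a ∈ A, (B : Set G).indicator v a ^ 2 = ∑ b ∈ B, v b ^ 2 := by
    rw [← Finset.sum_subset hB]
    · exact Finset.sum_congr rfl fun b hb => by rw [Set.indicator_of_mem (by simpa using hb)]
    · intro x _ hx
      rw [Set.indicator_of_notMem (by simpa using hx)]; simp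
  have h2 : ∑ a ∈ A, (B : Set G).indicator v (-a) ^ 2 = ∑ a ∈ A, (B : Set G).indicator v a ^ 2 :=
    Finset.sum_bij (fun a _ => -a) (fun a ha => hA a ha) (fun a _ b _ h => neg_injective h)
      (fun b hb => ⟨-b, hA b hb, neg_neg b⟩) (fun a _ => rfl)
  calc _ ≤ ∑ a ∈ A, (2 * (B : Set G).indicator v a ^ 2 + 2 * (B : Set G).indicator v (-a) ^ 2) :=
        Finset.sum_le_sum fun a _ => by
          rw [symmExt]
          nlinarith [sq_nonneg ((B : Set G).indicator v a - (B : Set G).indicator v (-a))]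
    _ = _ := by rw [Finset.sum_add_distrib, ← Finset.mul_sum, ← Finset.mul_sum, h2, h1]; ring

lemma divHull_mono {G : Type*} [CommGroup G] {ι κ : Type*} {S : ι → G} {T : κ → G}
    (h : Set.range S ⊆ Set.range T) : divHull S ≤ divHull T := by
  rintro u ⟨m, hm, hu⟩
  exact ⟨m, hm, Subgroup.closure_mono h hu⟩

lemma mem_divHull_of_mem_range {G : Type*} [CommGroup G] {ι : Type*} {S : ι → G} {u : G}
    (h : u ∈ Set.range S) : u ∈ divHull S :=
  ⟨1, one_pos, by rw [pow_one]; exact Subgroup.subset_closure h⟩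

lemma neg_mem_divHull {R : Type*} [CommRing R] {ι : Type*} {S : ι → Rˣ} {u : Rˣ}
    (h : u ∈ divHull S) : -u ∈ divHull S := by
  rw [← neg_one_mul]
  refine mul_mem ⟨2, two_pos, ?_⟩ h
  rw [neg_one_sq]
  exact one_mem _

lemma exists_sum_eq_of_ne_zero {K : Type*} [Field K] [CharZero K] (c : K) (D : ℕ) :
    ∃ (g l : K) (d : Fin (D + 2) → K), g ≠ 0 ∧ l ≠ 0 ∧ (∀ i, d i = g ∨ d i = l) ∧
      ∑ i, d i = -c := by
  have hD : ((D + 1 : ℕ) : K) ≠ 0 := Nat.cast_ne_zero.2 (Nat.succ_ne_zero D)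
  obtain ⟨g, hg, hl⟩ : ∃ g : K, g ≠ 0 ∧ -c - (D + 1 : ℕ) * g ≠ 0 := by
    by_cases h : -c - (D + 1 : ℕ) * (1 : K) = 0
    · refine ⟨2, two_ne_zero, fun h2 => hD ?_⟩
      linear_combination h - h2
    · exact ⟨1, one_ne_zero, h⟩
  refine ⟨g, -c - (D + 1 : ℕ) * g, Fin.cons (-c - (D + 1 : ℕ) * g) fun _ => g, hg, hl, ?_, ?_⟩
  · intro i
    refine Fin.cases (Or.inr ?_) (fun i => Or.inl ?_) i <;> simp
  · rw [Fin.sum_cons]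
    simp

lemma exists_sum_prod_le (ι : Type) [Fintype ι] [DecidableEq ι] (ρ : ℕ) :
    ∃ C : ℝ, 0 ≤ C ∧ ∀ (K : Type u) [Field K] [CharZero K] [DecidableEq K] (S : Fin ρ → Kˣ)
      (A : Finset K), (∀ a ∈ A, ∃ u ∈ divHull S, (u : K) = a) →
      ∀ (c : K) (w : ι → K → ℝ), (∀ i x, 0 ≤ w i x) →
        ∑ x ∈ (Fintype.piFinset fun _ : ι => A) with ∑ i, x i = c, ∏ i, w i (x i) ≤
          C * ∏ i, √(∑ a ∈ A, w i a ^ 2) := by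
  classical
  set s := Fintype.card ι + 2 with hs
  obtain ⟨C, hC, h0⟩ := exists_zeroNorm_sq_le.{u} (s := s) (by omega) (ρ + 2)
  refine ⟨√(4 * C) ^ 2 ^ s, by positivity, ?_⟩
  intro K _ _ _ S A hA c w hw
  obtain ⟨D, hD⟩ : ∃ D, Fintype.card ι + (D + 2) = 2 ^ s :=
    ⟨2 ^ s - (Fintype.card ι + 2), by have := (Nat.lt_two_pow_self (n := s)).le; omega⟩
  obtain ⟨g, l, d, hg, hl, hd, hdc⟩ := exists_sum_eq_of_ne_zero c D
  have e : Fin (2 ^ s) ≃ ι ⊕ Fin (D + 2) := by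
    refine (Fintype.equivFinOfCardEq ?_).symm
    rw [Fintype.card_sum, Fintype.card_fin, hD]
  set A1 : Finset K := A ∪ {g, l} with hA1
  set A' : Finset K := A1 ∪ A1.image (fun x => -x) with hA'
  have hsymm : ∀ a ∈ A', -a ∈ A' := by
    intro a ha
    rcases Finset.mem_union.1 ha with h | h
    · exact Finset.mem_union_right _ (Finset.mem_image_of_mem _ h)
    · obtain ⟨b, hb, rfl⟩ := Finset.mem_image.1 h
      rw [neg_neg]
      exact Finset.mem_union_left _ hb
  have hAA' : A ⊆ A' := Finset.subset_union_left.trans Finset.subset_union_left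
  have hdA' : ∀ j, d j ∈ A' := fun j => Finset.mem_union_left _ (Finset.mem_union_right _ (by
    rcases hd j with h | h <;> simp [h]))
  set S' : Fin (ρ + 2) → Kˣ := Fin.cons (Units.mk0 g hg) (Fin.cons (Units.mk0 l hl) S) with hS'
  have hS1 : ∀ a ∈ A1, ∃ u ∈ divHull S', (u : K) = a := by
    intro a ha
    rcases Finset.mem_union.1 ha with h | h
    · obtain ⟨u, hu, rfl⟩ := hA a h
      refine ⟨u, divHull_mono ?_ hu, rfl⟩
      rintro _ ⟨i, rfl⟩
      exact ⟨i.succ.succ, by simp [hS']⟩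
    · rw [Finset.mem_insert, Finset.mem_singleton] at h
      rcases h with rfl | rfl
      · exact ⟨_, mem_divHull_of_mem_range ⟨0, rfl⟩, rfl⟩
      · exact ⟨_, mem_divHull_of_mem_range ⟨1, rfl⟩, rfl⟩
  have hS2 : ∀ a ∈ A', ∃ u ∈ divHull S', (u : K) = a := by
    intro a ha
    rcases Finset.mem_union.1 ha with h | h
    · exact hS1 a h
    · obtain ⟨b, hb, rfl⟩ := Finset.mem_image.1 h
      obtain ⟨u, hu, rfl⟩ := hS1 b hb
      exact ⟨-u, neg_mem_divHull hu, by simp⟩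
  set v : ι ⊕ Fin (D + 2) → K → ℝ := Sum.elim (fun i => symmExt (A : Set K) (w i))
    (fun j => symmExt (({d j} : Finset K) : Set K) fun _ => 1) with hv
  have hv0 : ∀ i x, 0 ≤ v i x := by
    rintro (i | j) x
    · exact symmExt_nonneg (hw i) x
    · exact symmExt_nonneg (fun _ => zero_le_one) x
  have hvneg : ∀ i x, v i (-x) = v i x := by
    rintro (i | j) x <;> exact symmExt_neg _ _ x
  have hsum : ∀ i, ∑ a ∈ A', v i a ^ 2 ≤
      4 * Sum.elim (fun i => ∑ a ∈ A, w i a ^ 2) (fun _ => 1) i := by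
    rintro (i | j)
    · exact sum_symmExt_sq_le hsymm hAA' (w i)
    · refine (sum_symmExt_sq_le hsymm (by simpa using hdA' j) _).trans ?_
      simp
  have hnorm : ∀ i, zeroNorm s A' (v i) ≤
      √(4 * C) * √(Sum.elim (fun i => ∑ a ∈ A, w i a ^ 2) (fun _ => 1) i) := by
    intro i
    rw [← Real.sqrt_mul (by positivity)]
    refine Real.le_sqrt_of_sq_le ((h0 K S' A' hS2 hsymm (v i) (hv0 i) (hvneg i)).trans ?_)
    calc _ ≤ C * _ := mul_le_mul_of_nonneg_left (hsum i) hC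
      _ = _ := by ring
  have h1 : ∑ x ∈ (Fintype.piFinset fun _ : ι => A) with ∑ i, x i = c, ∏ i, w i (x i) ≤
      zeroSum A' (fun i => v (e i)) := by
    set F := (Fintype.piFinset fun _ : ι => A).filter fun x => ∑ i, x i = c
    have hmem : ∀ x ∈ F, ∀ i, x i ∈ A := fun x hx =>
      Fintype.mem_piFinset.1 (Finset.mem_filter.1 hx).1
    calc _ ≤ ∑ x ∈ F, ∏ i, v (e i) ((fun i => Sum.elim x d (e i)) i) := by
          refine Finset.sum_le_sum fun x hx => ?_
          rw [e.prod_comp (fun i => v i (Sum.elim x d i)), Fintype.prod_sum_type]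
          have h2 : (1 : ℝ) ≤ ∏ j, v (Sum.inr j) (Sum.elim x d (Sum.inr j)) := by
            rw [← Finset.prod_const_one (s := (Finset.univ : Finset (Fin (D + 2))))]
            refine Finset.prod_le_prod (fun _ _ => zero_le_one) fun j _ => ?_
            exact le_symmExt (v := fun _ => (1 : ℝ)) (fun _ => zero_le_one) (by simp)
          have h3 : ∏ i, w i (x i) ≤ ∏ i, v (Sum.inl i) (Sum.elim x d (Sum.inl i)) :=
            Finset.prod_le_prod (fun i _ => hw i _) fun i _ =>
              le_symmExt (hw i) (by simpa using hmem x hx i)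
          calc _ ≤ _ := h3
            _ ≤ _ := le_mul_of_one_le_right (Finset.prod_nonneg fun i _ => hv0 _ _) h2
      _ = ∑ y ∈ F.image (fun x i => Sum.elim x d (e i)), ∏ i, v (e i) (y i) := by
          rw [Finset.sum_image]
          intro x _ y _ hxy
          ext i
          simpa using congrFun hxy (e.symm (Sum.inl i))
      _ ≤ _ := by
          refine Finset.sum_le_sum_of_subset_of_nonneg (fun y hy => ?_)
            fun _ _ _ => Finset.prod_nonneg fun _ _ => hv0 _ _
          obtain ⟨x, hx, rfl⟩ := Finset.mem_image.1 hy
          refine Finset.mem_filter.2 ⟨Fintype.mem_piFinset.2 fun i => ?_, ?_⟩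
          · rcases e i with i | j
            · exact hAA' (hmem x hx i)
            · exact hdA' j
          · rw [e.sum_comp (Sum.elim x d), Fintype.sum_sum_type]
            simp only [Sum.elim_inl, Sum.elim_inr]
            rw [(Finset.mem_filter.1 hx).2, hdc, add_neg_cancel]
  calc _ ≤ _ := h1
    _ ≤ ∏ i, zeroNorm s A' (v (e i)) :=
      zeroSum_le_prod_zeroNorm s hsymm (fun i => hv0 _) (fun i => hvneg _)
    _ = ∏ i, zeroNorm s A' (v i) := e.prod_comp fun i => zeroNorm s A' (v i)
    _ ≤ ∏ i, √(4 * C) * √(Sum.elim (fun i => ∑ a ∈ A, w i a ^ 2) (fun _ => 1) i) :=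
      Finset.prod_le_prod (fun i _ => zeroNorm_nonneg _ _ (hv0 i)) fun i _ => hnorm i
    _ = _ := by
      rw [Finset.prod_mul_distrib, Finset.prod_const, Finset.card_univ, Fintype.card_sum,
        Fintype.card_fin, hD, Fintype.prod_sum_type]
      simp

end LinearEquation

section TracePowers

open Polynomial Matrix

variable {n R : Type*} [Fintype n] [DecidableEq n] [CommRing R]

lemma charpolyRev_comp (M : Matrix n n R) (q : R[X]) :
    M.charpolyRev.comp q = (1 - q • M.map C).det := by
  have h : M.charpolyRev.comp q = Polynomial.compRingHom q M.charpolyRev := rfl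
  rw [h, charpolyRev, RingHom.map_det]
  congr 1
  refine Matrix.ext fun i j => ?_
  by_cases hij : i = j
  · subst hij
    simp
    exact mul_comm _ _
  · simp [hij]
    exact mul_comm _ _

lemma charpolyRev_pow_comp (M : Matrix n n R) (k : ℕ) :
    (M ^ k).charpolyRev.comp (X ^ k) = (1 - ((X : R[X]) • M.map C) ^ k).det := by
  rw [charpolyRev_comp, _root_.smul_pow]
  congr 3
  exact map_pow (C : R →+* R[X]).mapMatrix M k

lemma charpolyRev_sq_comp (M : Matrix n n R) :
    (M ^ 2).charpolyRev.comp (X ^ 2) = M.charpolyRev * M.charpolyRev.comp (-X) := by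
  rw [charpolyRev_pow_comp, charpolyRev_comp, charpolyRev, ← det_mul]
  congr 1
  rw [neg_smul]
  generalize (X : R[X]) • M.map C = N
  noncomm_ring

lemma one_sub_mul_one_sub_smul_mul_one_sub_smul {S : Type*} [CommRing S] (N : Matrix n n S)
    (a b : S) : (1 - N) * (1 - a • N) * (1 - b • N) =
      1 - (b + a + 1) • N + (a * b + (b + a)) • N ^ 2 - (a * b) • N ^ 3 := by
  simp only [sub_mul, mul_sub, one_mul, mul_one, smul_mul_assoc, mul_smul_comm, add_smul,
    mul_smul, one_smul, pow_succ, pow_zero, smul_sub]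
  rw [smul_comm b a (N * N), smul_comm b a (N * N * N)]
  abel

lemma charpolyRev_cube_comp (M : Matrix n n R) {ω : R} (hω : ω ^ 2 + ω + 1 = 0) :
    (M ^ 3).charpolyRev.comp (X ^ 3) =
      M.charpolyRev * M.charpolyRev.comp (C ω * X) * M.charpolyRev.comp (C (ω ^ 2) * X) := by
  rw [charpolyRev_pow_comp, charpolyRev_comp, charpolyRev_comp, charpolyRev, ← det_mul, ← det_mul]
  congr 1
  simp only [mul_smul]
  set N : Matrix n n R[X] := (X : R[X]) • M.map C
  have h1 : (C (ω ^ 2) : R[X]) + C ω + 1 = 0 := by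
    rw [← C_add, ← C_1, ← C_add, hω, C_0]
  have h3 : (C ω : R[X]) * C (ω ^ 2) = 1 := by
    rw [← C_mul, ← C_1]
    congr 1
    linear_combination (ω - 1) * hω
  have h5 : (C ω : R[X]) * C (ω ^ 2) + (C (ω ^ 2) + C ω) = 0 := by
    rw [h3]; linear_combination h1
  rw [one_sub_mul_one_sub_smul_mul_one_sub_smul, h1, h5, h3]
  simp

lemma comp_X_pow_injective {k : ℕ} (hk : 0 < k) :
    Function.Injective fun p : R[X] => p.comp (X ^ k) := by
  intro p q h
  simp only [← expand_eq_comp_X_pow] at h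
  exact expand_injective hk h

lemma charpolyRev_eq_of_charpoly_eq {M N : Matrix n n R} (h : M.charpoly = N.charpoly) :
    M.charpolyRev = N.charpolyRev := by
  rw [← reverse_charpoly, ← reverse_charpoly, h]

lemma trace_eq_of_charpolyRev_eq {M N : Matrix n n R} (h : M.charpolyRev = N.charpolyRev) :
    M.trace = N.trace := by
  have := congrArg (fun p => p.coeff 1) h
  simpa using this

lemma charpolyRev_sq_eq {M N : Matrix n n R} (h : M.charpolyRev = N.charpolyRev) :
    (M ^ 2).charpolyRev = (N ^ 2).charpolyRev :=
  comp_X_pow_injective two_pos (by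
    change (M ^ 2).charpolyRev.comp (X ^ 2) = (N ^ 2).charpolyRev.comp (X ^ 2)
    rw [charpolyRev_sq_comp, charpolyRev_sq_comp, h])

lemma trace_cube_eq_of_charpoly_eq {K : Type*} [Field K] {M N : Matrix n n K}
    (h : M.charpoly = N.charpoly) : (M ^ 3).trace = (N ^ 3).trace := by
  set φ := algebraMap K (AlgebraicClosure K)
  obtain ⟨ω, hω⟩ := IsAlgClosed.exists_root (X ^ 2 + X + 1 : (AlgebraicClosure K)[X]) (by
    have : (X ^ 2 + X + 1 : (AlgebraicClosure K)[X]).degree = 2 := by compute_degree!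
    rw [this]; exact two_ne_zero)
  have hω' : ω ^ 2 + ω + 1 = 0 := by simpa using hω
  have h1 : (M.map φ).charpolyRev = (N.map φ).charpolyRev := by
    refine charpolyRev_eq_of_charpoly_eq ?_
    rw [charpoly_map, charpoly_map, h]
  have h2 : ((M.map φ) ^ 3).trace = ((N.map φ) ^ 3).trace :=
    trace_eq_of_charpolyRev_eq (comp_X_pow_injective (k := 3) (by norm_num) (by
      change ((M.map φ) ^ 3).charpolyRev.comp (X ^ 3) = ((N.map φ) ^ 3).charpolyRev.comp (X ^ 3)
      rw [charpolyRev_cube_comp _ hω', charpolyRev_cube_comp _ hω', h1]))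
  have h3 : ∀ P : Matrix n n K, ((P.map φ) ^ 3).trace = φ (P ^ 3).trace := by
    intro P
    have h4 : (P.map φ) ^ 3 = (P ^ 3).map φ := (map_pow φ.mapMatrix P 3).symm
    rw [h4]
    exact (AddMonoidHom.map_trace φ.toAddMonoidHom (P ^ 3)).symm
  rw [h3, h3] at h2
  exact φ.injective h2

lemma trace_sq_eq_of_charpoly_eq {M N : Matrix n n R} (h : M.charpoly = N.charpoly) :
    (M ^ 2).trace = (N ^ 2).trace :=
  trace_eq_of_charpolyRev_eq (charpolyRev_sq_eq (charpolyRev_eq_of_charpoly_eq h))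

lemma trace_pow_four_eq_of_charpoly_eq {M N : Matrix n n R} (h : M.charpoly = N.charpoly) :
    (M ^ 4).trace = (N ^ 4).trace := by
  have := trace_eq_of_charpolyRev_eq
    (charpolyRev_sq_eq (charpolyRev_sq_eq (charpolyRev_eq_of_charpoly_eq h)))
  rwa [← pow_mul, ← pow_mul] at this

lemma trace_cube_add {Z W D : Matrix n n R} (hW : W * W = D) (hD : (D * W).trace = 0) :
    ((Z + W) ^ 3).trace = (Z ^ 3).trace + 3 * (Z ^ 2 * W).trace + 3 * (Z * D).trace := by
  have h1 : (Z * W * Z).trace = (Z * Z * W).trace := (trace_mul_comm _ _).trans (by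
    rw [← mul_assoc])
  have h2 : (W * Z * Z).trace = (Z * Z * W).trace := by
    rw [mul_assoc, trace_mul_comm]
  have h3 : (W * Z * W).trace = (Z * D).trace := by
    rw [mul_assoc, trace_mul_comm, mul_assoc, hW]
  have h4 : (W * W * Z).trace = (Z * D).trace := by rw [hW, trace_mul_comm]
  have h5 : (Z * W * W).trace = (Z * D).trace := by rw [mul_assoc, hW]
  have h6 : (W * W * W).trace = 0 := by rw [hW, hD]
  simp only [pow_succ, pow_zero, one_mul, add_mul, mul_add, trace_add, h1, h2, h3, h4, h5, h6]
  ring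

lemma trace_pow_four_add {Z W D : Matrix n n R} (hW : W * W = D) :
    ((Z + W) ^ 4).trace = (Z ^ 4).trace + 4 * ((Z ^ 3 + Z * D) * W).trace +
      2 * (Z * W * Z * W).trace + 4 * (Z ^ 2 * D).trace + (D ^ 2).trace := by
  have c : ∀ P Q S T : Matrix n n R, (P * Q * S * T).trace = (Q * S * T * P).trace := by
    intro P Q S T
    rw [mul_assoc, mul_assoc, trace_mul_comm, ← mul_assoc]
  have h1 : (Z * Z * D).trace = (Z * Z * W * W).trace := by rw [← hW, mul_assoc (Z * Z)]
  have h2 : (Z * D * W).trace = (Z * W * W * W).trace := by rw [← hW, mul_assoc Z W W]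
  have h3 : (D * D).trace = (W * W * W * W).trace := by rw [← hW, ← mul_assoc]
  have a1 := c W Z Z Z
  have a2 := (c Z W Z Z).trans a1
  have a3 := (c Z Z W Z).trans a2
  have b1 := c W Z Z W
  have b2 := (c W W Z Z).trans b1
  have b3 := (c Z W W Z).trans b2
  have d := c W Z W Z
  have e1 := c W Z W W
  have e2 := (c W W Z W).trans e1
  have e3 := (c W W W Z).trans e2
  simp only [pow_succ, pow_zero, one_mul, add_mul, mul_add, trace_add, h1, h2, h3]
  simp only [a1, a2, a3, b1, b2, b3, d, e1, e2, e3]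
  ring

lemma trace_mul_single_eq_mul (M : Matrix n n R) (p q : n) (u : R) :
    (M * single p q u).trace = u * M q p := by
  rw [trace_mul_comm, trace_single_mul, smul_eq_mul]

end TracePowers

section RootCounts

open Polynomial

variable {K : Type*} [Field K]

lemma card_le_of_injOn_of_eval_eq_zero {α : Type*} [DecidableEq K] {T : Finset α} {g : α → K}
    {P : K[X]} {d : ℕ} (hg : Set.InjOn g T) (hP : P ≠ 0) (hd : P.natDegree ≤ d)
    (h : ∀ x ∈ T, P.eval (g x) = 0) : T.card ≤ d := by
  rw [← Finset.card_image_of_injOn hg]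
  refine (Polynomial.card_le_degree_of_subset_roots (p := P) ?_).trans hd
  intro z hz
  obtain ⟨x, hx, rfl⟩ := Finset.mem_image.1 (Finset.mem_def.2 hz)
  exact (Polynomial.mem_roots hP).2 (h x hx)

lemma card_le_two_of_quadratic {α : Type*} {T : Finset α} {g : α → K} {a b c : K}
    (hg : Set.InjOn g T) (ha : a ≠ 0) (h : ∀ x ∈ T, a * g x ^ 2 + b * g x + c = 0) :
    T.card ≤ 2 := by
  classical
  refine card_le_of_injOn_of_eval_eq_zero (P := C a * X ^ 2 + C b * X + C c) hg ?_
    natDegree_quadratic_le ?_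
  · intro h0
    exact ha (by simpa using congrArg (fun p => p.coeff 2) h0)
  · intro x hx
    simpa using h x hx

lemma resultant_quadratic_eq_zero {u A₁ B₁ C₁ A₂ B₂ C₂ : K} (hu : u ≠ 0)
    (h₁ : A₁ * u ^ 2 + B₁ * u + C₁ = 0) (h₂ : A₂ * u ^ 2 + B₂ * u + C₂ = 0) :
    (A₁ * C₂ - A₂ * C₁) ^ 2 - (A₁ * B₂ - A₂ * B₁) * (B₁ * C₂ - B₂ * C₁) = 0 := by
  have h3 : (A₁ * C₂ - A₂ * C₁) * u + (B₁ * C₂ - B₂ * C₁) = 0 := by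
    apply mul_left_cancel₀ hu
    linear_combination C₂ * h₁ - C₁ * h₂
  have h4 : (A₁ * B₂ - A₂ * B₁) * u + (A₁ * C₂ - A₂ * C₁) = 0 := by
    linear_combination A₁ * h₂ - A₂ * h₁
  linear_combination (A₁ * C₂ - A₂ * C₁) * h4 - (A₁ * B₂ - A₂ * B₁) * h3

lemma natDegree_resultant_le_and_ne_zero {α γ δ κ κ' a b c d c₁ c₂ c₃ c₄ y e : K}
    (ha : a ≠ 0) (hγ : γ ≠ 0) (hy : y ≠ 0) (hc : c ≠ 0) :
    let A₁ : K[X] := C α * X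
    let B₁ : K[X] := C γ * X ^ 2 + C κ * X + C δ
    let C₁ : K[X] := C e * X
    let A₂ : K[X] := C a * X ^ 2 + C c₁ * X + C b
    let B₂ : K[X] := C c₃ * X ^ 2 + C κ' * X + C c₄
    let C₂ : K[X] := C y * (C c * X ^ 2 + C c₂ * X + C d)
    let P := (A₁ * C₂ - A₂ * C₁) ^ 2 - (A₁ * B₂ - A₂ * B₁) * (B₁ * C₂ - B₂ * C₁)
    P.natDegree ≤ 8 ∧ P ≠ 0 := by
  intro A₁ B₁ C₁ A₂ B₂ C₂ P
  have hA₁ : A₁.natDegree ≤ 1 := by unfold A₁; compute_degree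
  have hB₁ : B₁.natDegree ≤ 2 := by unfold B₁; compute_degree
  have hC₁ : C₁.natDegree ≤ 1 := by unfold C₁; compute_degree
  have hA₂ : A₂.natDegree ≤ 2 := by unfold A₂; compute_degree
  have hB₂ : B₂.natDegree ≤ 2 := by unfold B₂; compute_degree
  have hC₂ : C₂.natDegree ≤ 2 := by unfold C₂; compute_degree
  have h1 : (A₁ * C₂ - A₂ * C₁).natDegree ≤ 3 :=
    natDegree_sub_le_of_le (natDegree_mul_le_of_le hA₁ hC₂) (natDegree_mul_le_of_le hA₂ hC₁)
  have h2 : (A₁ * B₂).natDegree ≤ 3 := natDegree_mul_le_of_le hA₁ hB₂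
  have h3 : (A₂ * B₁).natDegree ≤ 4 := natDegree_mul_le_of_le hA₂ hB₁
  have h4 : (B₁ * C₂).natDegree ≤ 4 := natDegree_mul_le_of_le hB₁ hC₂
  have h5 : (B₂ * C₁).natDegree ≤ 3 := natDegree_mul_le_of_le hB₂ hC₁
  have h6 : (A₁ * B₂ - A₂ * B₁).natDegree ≤ 4 :=
    natDegree_sub_le_of_le (h2.trans (by norm_num : 3 ≤ 4)) h3
  have h7 : (B₁ * C₂ - B₂ * C₁).natDegree ≤ 4 :=
    natDegree_sub_le_of_le h4 (h5.trans (by norm_num : 3 ≤ 4))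
  have h8 : ((A₁ * C₂ - A₂ * C₁) ^ 2).natDegree ≤ 6 := natDegree_pow_le_of_le 2 h1
  refine ⟨natDegree_sub_le_of_le (h8.trans (by norm_num : 6 ≤ 8)) (natDegree_mul_le_of_le h6 h7), ?_⟩
  intro hP
  have h9 := congrArg (fun p => p.coeff (4 + 4)) hP
  have h10 : (A₁ * B₂ - A₂ * B₁).coeff 4 = - (a * γ) := by
    rw [coeff_sub, coeff_eq_zero_of_natDegree_lt (h2.trans_lt (by norm_num)),
      coeff_mul_add_eq_of_natDegree_le (df := 2) (dg := 2) hA₂ hB₁]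
    simp [A₂, B₁]
  have h11 : (B₁ * C₂ - B₂ * C₁).coeff 4 = γ * (y * c) := by
    rw [coeff_sub, coeff_eq_zero_of_natDegree_lt (h5.trans_lt (by norm_num)),
      coeff_mul_add_eq_of_natDegree_le (df := 2) (dg := 2) hB₁ hC₂]
    simp [C₂, B₁]
  simp only [P] at h9
  rw [coeff_sub, coeff_mul_add_eq_of_natDegree_le h6 h7, h10, h11,
    coeff_eq_zero_of_natDegree_lt (h8.trans_lt (by norm_num)), coeff_zero] at h9
  simp [ha, hγ, hy, hc] at h9

lemma card_le_sixteen_of_quadratics {ι : Type*} {T : Finset ι} {g h : ι → K}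
    {α γ δ κ κ' a b c d c₁ c₂ c₃ c₄ y e : K}
    (hgh : ∀ s ∈ T, ∀ t ∈ T, g s = g t → h s = h t → s = t)
    (hg0 : ∀ t ∈ T, g t ≠ 0) (hh0 : ∀ t ∈ T, h t ≠ 0)
    (hα : α ≠ 0) (ha : a ≠ 0) (hγ : γ ≠ 0) (hy : y ≠ 0) (hc : c ≠ 0)
    (h₁ : ∀ t ∈ T, α * h t * g t ^ 2 + (γ * h t ^ 2 + κ * h t + δ) * g t + e * h t = 0)
    (h₂ : ∀ t ∈ T, (a * h t ^ 2 + c₁ * h t + b) * g t ^ 2 +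
      (c₃ * h t ^ 2 + κ' * h t + c₄) * g t + y * (c * h t ^ 2 + c₂ * h t + d) = 0) :
    T.card ≤ 16 := by
  classical
  have hfib : ∀ z ∈ T.image h, (T.filter fun t => h t = z).card ≤ 2 := by
    intro z hz
    obtain ⟨t₀, ht₀, rfl⟩ := Finset.mem_image.1 hz
    refine card_le_two_of_quadratic (g := g) (a := α * h t₀)
      (b := γ * h t₀ ^ 2 + κ * h t₀ + δ) (c := e * h t₀) ?_ (mul_ne_zero hα (hh0 _ ht₀)) ?_
    · intro s hs t ht hst
      simp only [Finset.coe_filter, Set.mem_ofPred_eq] at hs ht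
      exact hgh s hs.1 t ht.1 hst (hs.2.trans ht.2.symm)
    · intro t ht
      rw [Finset.mem_filter] at ht
      rw [← ht.2]
      exact h₁ t ht.1
  have himg : (T.image h).card ≤ 8 := by
    obtain ⟨hd, hP⟩ := natDegree_resultant_le_and_ne_zero (α := α) (γ := γ) (δ := δ) (κ := κ)
      (κ' := κ') (a := a) (b := b) (c := c) (d := d) (c₁ := c₁) (c₂ := c₂) (c₃ := c₃) (c₄ := c₄)
      (y := y) (e := e) ha hγ hy hc
    refine card_le_of_injOn_of_eval_eq_zero (g := id) Function.injective_id.injOn hP hd ?_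
    intro z hz
    obtain ⟨t, ht, rfl⟩ := Finset.mem_image.1 hz
    have := resultant_quadratic_eq_zero (hg0 t ht) (h₁ t ht) (h₂ t ht)
    simpa using this
  calc T.card ≤ 2 * (T.image h).card := Finset.card_le_mul_card_image T 2 hfib
    _ ≤ 16 := by omega

end RootCounts

section EdgeEquations

open Matrix

variable {n K : Type*} [Fintype n] [DecidableEq n] [Field K] [CharZero K]

/-- The matrix supported on the entries `(p, q)` and `(q, p)`. -/
def edgeMatrix (p q : n) (u v : K) : Matrix n n K := single p q u + single q p v

omit [CharZero K] in
lemma edgeMatrix_mul_self {p q : n} (hpq : p ≠ q) (u v : K) :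
    edgeMatrix p q u v * edgeMatrix p q u v = single p p (u * v) + single q q (u * v) := by
  simp [edgeMatrix, add_mul, mul_add, hpq, hpq.symm, mul_comm v u, add_comm]

omit [CharZero K] in
lemma trace_mul_edgeMatrix (M : Matrix n n K) (p q : n) (u v : K) :
    (M * edgeMatrix p q u v).trace = u * M q p + v * M p q := by
  simp only [edgeMatrix, mul_add, trace_add, trace_mul_single_eq_mul]

omit [CharZero K] in
lemma trace_mul_single_mul_single (Z : Matrix n n K) (a b c d : n) (u v : K) :
    (Z * single a b u * Z * single c d v).trace = u * v * Z d a * Z b c := by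
  rw [trace_mul_single_eq_mul, Matrix.mul_apply, Finset.sum_eq_single b]
  · rw [mul_single_apply_same]; ring
  · intro k _ hk
    rw [mul_single_apply_of_ne _ _ _ _ _ hk, zero_mul]
  · simp

omit [CharZero K] in
lemma trace_mul_edgeMatrix_mul_edgeMatrix (Z : Matrix n n K) {p q r s : n} (hpq : Z p q = 0)
    (hqp : Z q p = 0) (hrs : Z r s = 0) (hsr : Z s r = 0) (u u' v v' : K) :
    (Z * (edgeMatrix p q u u' + edgeMatrix r s v v') * Z *
      (edgeMatrix p q u u' + edgeMatrix r s v v')).trace =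
      2 * (u * u') * (Z p p * Z q q) + 2 * (v * v') * (Z r r * Z s s) +
      2 * (u * v * (Z q r * Z s p) + u * v' * (Z q s * Z r p) +
        u' * v * (Z p r * Z s q) + u' * v' * (Z p s * Z r q)) := by
  simp only [edgeMatrix, mul_add, add_mul, trace_add, trace_mul_single_mul_single, hpq, hqp, hrs,
    hsr]
  ring

lemma card_le_two_of_edge {T : Finset (Matrix n n K)} {Z : Matrix n n K} {p q : n} (hpq : p ≠ q)
    {y t : K} (hy : y ≠ 0) (hZ : ∀ X ∈ T, X = Z + edgeMatrix p q (X p q) (X q p))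
    (hmul : ∀ X ∈ T, X p q * X q p = y) (ht : ∀ X ∈ T, (X ^ 3).trace = t)
    (hα : (Z ^ 2) q p ≠ 0) : T.card ≤ 2 := by
  have h3 : (3 : K) ≠ 0 := three_ne_zero
  have key : ∀ X ∈ T, t = (Z ^ 3).trace + 3 * (X p q * (Z ^ 2) q p + X q p * (Z ^ 2) p q) +
      3 * (Z * (single p p y + single q q y)).trace := by
    intro X hX
    rw [← ht X hX]
    conv_lhs => rw [hZ X hX]
    rw [trace_cube_add (edgeMatrix_mul_self hpq _ _), trace_mul_edgeMatrix, hmul X hX]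
    rw [trace_mul_edgeMatrix]
    simp [hpq, hpq.symm]
  obtain rfl | ⟨X₁, hX₁⟩ := T.eq_empty_or_nonempty
  · simp
  refine card_le_two_of_quadratic (g := fun X => X p q) (a := (Z ^ 2) q p)
    (b := -(X₁ p q * (Z ^ 2) q p + X₁ q p * (Z ^ 2) p q)) (c := (Z ^ 2) p q * y) ?_ hα ?_
  · intro X hX X' hX' h
    have hX0 : X p q ≠ 0 := fun h0 => hy (by rw [← hmul X hX, h0, zero_mul])
    have h' : X q p = X' q p := by
      apply mul_left_cancel₀ hX0
      rw [hmul X hX, ← hmul X' hX']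
      exact congrArg (· * X' q p) h.symm
    rw [hZ X hX, hZ X' hX', h']
    exact congrArg (fun u => Z + edgeMatrix p q u _) h
  · intro X hX
    have e1 : X p q * (Z ^ 2) q p + X q p * (Z ^ 2) p q =
        X₁ p q * (Z ^ 2) q p + X₁ q p * (Z ^ 2) p q := by
      apply mul_left_cancel₀ h3
      linear_combination (key X₁ hX₁) - key X hX
    linear_combination X p q * e1 - (Z ^ 2) p q * hmul X hX

lemma card_le_sixteen_of_edges {T : Finset (Matrix n n K)} {Z : Matrix n n K} {p q r s : n}
    (hpq : p ≠ q) (hrs : r ≠ s) (hpr : p ≠ r) (hps : p ≠ s) (hqr : q ≠ r) (hqs : q ≠ s)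
    {y y' t t' : K} (hy : y ≠ 0) (hy' : y' ≠ 0)
    (hZ : ∀ X ∈ T, X = Z + (edgeMatrix p q (X p q) (X q p) + edgeMatrix r s (X r s) (X s r)))
    (hmul : ∀ X ∈ T, X p q * X q p = y) (hmul' : ∀ X ∈ T, X r s * X s r = y')
    (ht : ∀ X ∈ T, (X ^ 3).trace = t) (ht' : ∀ X ∈ T, (X ^ 4).trace = t')
    (hα : (Z ^ 2) q p ≠ 0) (hγ : (Z ^ 2) s r ≠ 0)
    (hqr0 : Z q r ≠ 0) (hsp0 : Z s p ≠ 0) (hpr0 : Z p r ≠ 0) (hsq0 : Z s q ≠ 0) :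
    T.card ≤ 16 := by
  obtain rfl | ⟨X₁, hX₁⟩ := T.eq_empty_or_nonempty
  · simp
  have hz : Z p q = 0 ∧ Z q p = 0 ∧ Z r s = 0 ∧ Z s r = 0 := by
    have h := fun i j => congrFun (congrFun (hZ X₁ hX₁) i) j
    have h1 := h p q
    have h2 := h q p
    have h3 := h r s
    have h4 := h s r
    simp [edgeMatrix, hpq, hpq.symm, hrs, hrs.symm, hpr, hpr.symm, hps, hps.symm,
      hqr, hqr.symm, hqs, hqs.symm] at h1 h2 h3 h4
    exact ⟨h1, h2, h3, h4⟩
  obtain ⟨z1, z2, z3, z4⟩ := hz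
  set D : Matrix n n K := single p p y + single q q y + (single r r y' + single s s y') with hD
  have hW : ∀ X ∈ T, (edgeMatrix p q (X p q) (X q p) + edgeMatrix r s (X r s) (X s r)) *
      (edgeMatrix p q (X p q) (X q p) + edgeMatrix r s (X r s) (X s r)) = D := by
    intro X hX
    have h1 : edgeMatrix p q (X p q) (X q p) * edgeMatrix r s (X r s) (X s r) = 0 := by
      simp [edgeMatrix, add_mul, mul_add, hpr, hps, hqr, hqs]
    have h2 : edgeMatrix r s (X r s) (X s r) * edgeMatrix p q (X p q) (X q p) = 0 := by
      simp [edgeMatrix, add_mul, mul_add, hpr.symm, hps.symm, hqr.symm, hqs.symm]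
    rw [add_mul, mul_add, mul_add, h1, h2, edgeMatrix_mul_self hpq, edgeMatrix_mul_self hrs,
      hmul X hX, hmul' X hX, add_zero, zero_add]
  have key : ∀ X ∈ T, t = (Z ^ 3).trace + 3 * (X p q * (Z ^ 2) q p + X q p * (Z ^ 2) p q +
      (X r s * (Z ^ 2) s r + X s r * (Z ^ 2) r s)) + 3 * (Z * D).trace := by
    intro X hX
    rw [← ht X hX]
    conv_lhs => rw [hZ X hX]
    rw [trace_cube_add (hW X hX), mul_add (Z ^ 2), trace_add, trace_mul_edgeMatrix,
      trace_mul_edgeMatrix]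
    rw [mul_add, trace_add, trace_mul_edgeMatrix, trace_mul_edgeMatrix]
    simp [hD, hpq, hpq.symm, hrs, hrs.symm, hpr, hpr.symm, hps, hps.symm,
      hqr, hqr.symm, hqs, hqs.symm]
  set M := Z ^ 3 + Z * D with hM
  have key' : ∀ X ∈ T, t' = (Z ^ 4).trace +
      4 * (X p q * M q p + X q p * M p q + (X r s * M s r + X s r * M r s)) +
      2 * (2 * y * (Z p p * Z q q) + 2 * y' * (Z r r * Z s s) +
      2 * (X p q * X r s * (Z q r * Z s p) + X p q * X s r * (Z q s * Z r p) +
        X q p * X r s * (Z p r * Z s q) + X q p * X s r * (Z p s * Z r q))) +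
      4 * (Z ^ 2 * D).trace + (D ^ 2).trace := by
    intro X hX
    rw [← ht' X hX]
    conv_lhs => rw [hZ X hX]
    rw [trace_pow_four_add (hW X hX), ← hM, mul_add M, trace_add, trace_mul_edgeMatrix,
      trace_mul_edgeMatrix, trace_mul_edgeMatrix_mul_edgeMatrix Z z1 z2 z3 z4, hmul X hX,
      hmul' X hX]
  have hne : ∀ X ∈ T, X p q ≠ 0 := fun X hX h0 => hy (by rw [← hmul X hX, h0, zero_mul])
  have hne' : ∀ X ∈ T, X r s ≠ 0 := fun X hX h0 => hy' (by rw [← hmul' X hX, h0, zero_mul])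
  have h3 : (3 : K) ≠ 0 := three_ne_zero
  have h4 : (4 : K) ≠ 0 := by norm_num
  obtain ⟨κ, hκ⟩ : ∃ κ, ∀ X ∈ T, X p q * (Z ^ 2) q p + X q p * (Z ^ 2) p q +
      (X r s * (Z ^ 2) s r + X s r * (Z ^ 2) r s) = κ :=
    ⟨X₁ p q * (Z ^ 2) q p + X₁ q p * (Z ^ 2) p q +
      (X₁ r s * (Z ^ 2) s r + X₁ s r * (Z ^ 2) r s), fun X hX => mul_left_cancel₀ h3 (by linear_combination key X₁ hX₁ - key X hX)⟩
  obtain ⟨κ', hκ'⟩ : ∃ κ', ∀ X ∈ T,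
      X p q * M q p + X q p * M p q + (X r s * M s r + X s r * M r s) +
      (X p q * X r s * (Z q r * Z s p) + X p q * X s r * (Z q s * Z r p) +
        X q p * X r s * (Z p r * Z s q) + X q p * X s r * (Z p s * Z r q)) = κ' :=
    ⟨X₁ p q * M q p + X₁ q p * M p q + (X₁ r s * M s r + X₁ s r * M r s) +
      (X₁ p q * X₁ r s * (Z q r * Z s p) + X₁ p q * X₁ s r * (Z q s * Z r p) +
        X₁ q p * X₁ r s * (Z p r * Z s q) + X₁ q p * X₁ s r * (Z p s * Z r q)), fun X hX => mul_left_cancel₀ h4 (by linear_combination key' X₁ hX₁ - key' X hX)⟩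
  generalize hA : M q p = c₁ at hκ'
  generalize hB : M p q = c₂ at hκ'
  generalize hC : M s r = c₃ at hκ'
  generalize hE : M r s = c₄ at hκ'
  generalize (Z ^ 2) q p = α at *
  generalize (Z ^ 2) p q = β at *
  generalize (Z ^ 2) s r = γ at *
  generalize (Z ^ 2) r s = δ at *
  refine card_le_sixteen_of_quadratics (g := fun X : Matrix n n K => X p q)
    (h := fun X : Matrix n n K => X r s)
    (α := α) (γ := γ) (κ := -κ) (δ := δ * y') (e := β * y)
    (a := Z q r * Z s p) (c₁ := c₁) (b := Z q s * Z r p * y')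
    (c₃ := c₃) (κ' := -κ') (c₄ := c₄ * y') (y := y) (c := Z p r * Z s q) (c₂ := c₂)
    (d := Z p s * Z r q * y') ?_ hne hne' hα (mul_ne_zero hqr0 hsp0) hγ hy
    (mul_ne_zero hpr0 hsq0) ?_ ?_
  · intro X hX X' hX' h h'
    have e1 : X q p = X' q p := by
      apply mul_left_cancel₀ (hne X hX)
      rw [hmul X hX, ← hmul X' hX', h]
    have e2 : X s r = X' s r := by
      apply mul_left_cancel₀ (hne' X hX)
      rw [hmul' X hX, ← hmul' X' hX', h']
    rw [hZ X hX, hZ X' hX', e1, e2, h, h']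
  · intro X hX
    have m1 := hmul X hX
    have m2 := hmul' X hX
    have e := hκ X hX
    linear_combination X p q * X r s * e - β * X r s * m1 - δ * X p q * m2
  · intro X hX
    have m1 := hmul X hX
    have m2 := hmul' X hX
    have e := hκ' X hX
    generalize X p q = u at *
    generalize X q p = u' at *
    generalize X r s = v at *
    generalize X s r = v' at *
    linear_combination u * v * e - (c₂ * v) * m1 - c₄ * u * m2 - u ^ 2 * (Z q s * Z r p) * m2 -
      v ^ 2 * (Z p r * Z s q) * m1 - (Z p s * Z r q) * (u * u' * m2 + y' * m1)

end EdgeEquations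

section MulRep

open scoped Pointwise

variable {K : Type*} [Field K] [DecidableEq K]

/-- The number of representations of `y` as a product of two elements of `A`. -/
def mulRep (A : Finset K) (y : K) : ℕ := ((A ×ˢ A).filter fun x => x.1 * x.2 = y).card

lemma sum_mulRep (A : Finset K) : ∑ y ∈ A * A, mulRep A y = A.card ^ 2 := by
  rw [sq, ← Finset.card_product]
  refine (Finset.card_eq_sum_card_fiberwise fun x hx => ?_).symm
  obtain ⟨h1, h2⟩ := Finset.mem_product.1 (Finset.mem_coe.1 hx)
  exact Finset.mem_coe.2 (Finset.mul_mem_mul h1 h2)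

lemma mulRep_le_card {A : Finset K} (hA : (0 : K) ∉ A) (y : K) : mulRep A y ≤ A.card := by
  refine Finset.card_le_card_of_injOn Prod.fst (fun x hx => ?_) fun x hx x' hx' h => ?_
  · exact (Finset.mem_product.1 (Finset.mem_filter.1 hx).1).1
  · obtain ⟨h1, h2⟩ := Finset.mem_filter.1 (Finset.mem_coe.1 hx)
    obtain ⟨h1', h2'⟩ := Finset.mem_filter.1 (Finset.mem_coe.1 hx')
    have h0 : x.1 ≠ 0 := fun h0 => hA (h0 ▸ (Finset.mem_product.1 h1).1)
    refine Prod.ext h (mul_left_cancel₀ h0 ?_)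
    rw [h2, ← h2', h]

lemma one_le_mulRep {A : Finset K} {a b : K} (ha : a ∈ A) (hb : b ∈ A) :
    1 ≤ mulRep A (a * b) :=
  Finset.card_pos.2 ⟨(a, b), by simp [ha, hb]⟩

/-- The number of representations, or its square root when `b` holds. -/
noncomputable def repWeight (A : Finset K) (b : Prop) [Decidable b] (y : K) : ℝ :=
  if b then √(mulRep A y) else mulRep A y

lemma repWeight_nonneg (A : Finset K) (b : Prop) [Decidable b] (y : K) : 0 ≤ repWeight A b y := by
  unfold repWeight
  split_ifs <;> positivity

lemma sqrt_sum_repWeight_sq_le {A : Finset K} (hA : (0 : K) ∉ A) (b : Prop) [Decidable b] :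
    √(∑ y ∈ A * A, repWeight A b y ^ 2) ≤ (A.card : ℝ) ^ (if b then (1 : ℝ) else 3 / 2) := by
  have hs : ∑ y ∈ A * A, (mulRep A y : ℝ) = (A.card : ℝ) ^ 2 := by exact_mod_cast sum_mulRep A
  unfold repWeight
  split_ifs with h
  · rw [Real.rpow_one]
    apply Real.sqrt_le_iff.2 ⟨by positivity, ?_⟩
    rw [← hs]
    exact (Finset.sum_congr rfl fun y _ => Real.sq_sqrt (by positivity)).le
  · have h3 : ((A.card : ℝ) ^ (3 / 2 : ℝ)) = √((A.card : ℝ) ^ 3) := by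
      rw [Real.sqrt_eq_rpow, ← Real.rpow_natCast, ← Real.rpow_mul (by positivity)]
      norm_num
    rw [h3]
    apply Real.sqrt_le_sqrt
    calc ∑ y ∈ A * A, (mulRep A y : ℝ) ^ 2 ≤ ∑ y ∈ A * A, (A.card : ℝ) * mulRep A y := by
          refine Finset.sum_le_sum fun y _ => ?_
          rw [sq]
          gcongr
          exact mulRep_le_card hA y
      _ = (A.card : ℝ) ^ 3 := by rw [← Finset.mul_sum, hs]; ring

end MulRep

section Edges

variable {n : ℕ}

/-- The pairs `i < j`, viewed as the edges of the complete graph on `Fin n`. -/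
abbrev OrdEdge (n : ℕ) : Type := {e : Fin n × Fin n // e.1 < e.2}

/-- The edge with distinct end points `i` and `j`. -/
def edgeOf {i j : Fin n} (h : i ≠ j) : OrdEdge n :=
  if h' : i < j then ⟨(i, j), h'⟩ else ⟨(j, i), lt_of_le_of_ne (not_lt.1 h') h.symm⟩

lemma edgeOf_eq {i j : Fin n} (h : i ≠ j) :
    (edgeOf h).1 = (i, j) ∨ (edgeOf h).1 = (j, i) := by
  unfold edgeOf
  split_ifs <;> simp

lemma eq_or_eq_of_edgeOf_eq {i j k l : Fin n} (h : i ≠ j) (h' : k ≠ l)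
    (he : edgeOf h = edgeOf h') : i = k ∧ j = l ∨ i = l ∧ j = k := by
  have := congrArg Subtype.val he
  rcases edgeOf_eq h with h1 | h1 <;> rcases edgeOf_eq h' with h2 | h2 <;>
    rw [h1, h2, Prod.mk.injEq] at this <;> grind

variable {K : Type*} [Field K]

/-- The products of opposite entries of a matrix. -/
def edgeProd (X : Matrix (Fin n) (Fin n) K) (e : OrdEdge n) : K :=
  X e.1.1 e.1.2 * X e.1.2 e.1.1

lemma edgeProd_edgeOf (X : Matrix (Fin n) (Fin n) K) {i j : Fin n} (h : i ≠ j) :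
    edgeProd X (edgeOf h) = X i j * X j i := by
  rcases edgeOf_eq h with h1 | h1 <;> simp [edgeProd, h1, mul_comm]

lemma sum_univ_prod_eq_of_symm {n : ℕ} (f : Fin n × Fin n → K) (hf : ∀ x, f x.swap = f x) :
    ∑ x, f x = ∑ i, f (i, i) + 2 * ∑ e : OrdEdge n, f e.1 := by
  have h1 : ∑ x, f x = ∑ x, (if x.1 = x.2 then f x else 0) +
      ∑ x, (if x.1 < x.2 then f x else 0) + ∑ x, (if x.2 < x.1 then f x else 0) := by
    rw [← Finset.sum_add_distrib, ← Finset.sum_add_distrib]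
    refine Finset.sum_congr rfl fun x _ => ?_
    rcases lt_trichotomy x.1 x.2 with h | h | h
    · simp [h, h.ne, h.asymm]
    · simp [h]
    · simp [h, h.ne', h.asymm]
  have h2 : ∑ x : Fin n × Fin n, (if x.1 = x.2 then f x else 0) = ∑ i, f (i, i) := by
    rw [Fintype.sum_prod_type]
    simp
  have h3 : ∑ x : Fin n × Fin n, (if x.1 < x.2 then f x else 0) = ∑ e : OrdEdge n, f e.1 := by
    rw [← Finset.sum_filter]
    exact Finset.sum_subtype _ (by simp) f
  have h4 : ∑ x : Fin n × Fin n, (if x.2 < x.1 then f x else 0) =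
      ∑ x : Fin n × Fin n, (if x.1 < x.2 then f x else 0) := by
    refine Fintype.sum_equiv (Equiv.prodComm _ _) _ _ fun x => ?_
    simp [hf]
  rw [h1, h2, h4, h3]
  ring

lemma trace_sq_eq (X : Matrix (Fin n) (Fin n) K) :
    (X ^ 2).trace = ∑ i, X i i ^ 2 + 2 * ∑ e, edgeProd X e := by
  have := sum_univ_prod_eq_of_symm (fun x : Fin n × Fin n => X x.1 x.2 * X x.2 x.1)
    fun x => mul_comm _ _
  rw [Fintype.sum_prod_type] at this
  simp only [sq, Matrix.trace, Matrix.diag, Matrix.mul_apply, this]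
  rfl

/-- Matrices with the same diagonal and the same entries off the edges in `D`. -/
def AgreeOff (D : Finset (OrdEdge n)) (X Y : Matrix (Fin n) (Fin n) K) : Prop :=
  (∀ i, X i i = Y i i) ∧
    ∀ e, e ∉ D → X e.1.1 e.1.2 = Y e.1.1 e.1.2 ∧ X e.1.2 e.1.1 = Y e.1.2 e.1.1

omit [Field K] in
lemma AgreeOff.apply_eq {D : Finset (OrdEdge n)} {X Y : Matrix (Fin n) (Fin n) K}
    (h : AgreeOff D X Y) {i j : Fin n} (hij : ∀ h : i ≠ j, edgeOf h ∉ D) : X i j = Y i j := by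
  by_cases hd : i = j
  · subst hd
    exact h.1 i
  · have h1 := h.2 _ (hij hd)
    rcases edgeOf_eq hd with h2 | h2 <;> rw [h2] at h1
    exacts [h1.1, h1.2]

variable [DecidableEq K]

/-- The matrices in `T` with prescribed diagonal and prescribed products of opposite entries. -/
def diagProdFiber (T : Finset (Matrix (Fin n) (Fin n) K)) (d : Fin n → K) (y : OrdEdge n → K) :
    Finset (Matrix (Fin n) (Fin n) K) :=
  T.filter fun X => (fun i => X i i) = d ∧ edgeProd X = y

lemma card_diagProdFiber_le {A : Finset K} {T : Finset (Matrix (Fin n) (Fin n) K)}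
    (hT : ∀ X ∈ T, ∀ i j, X i j ∈ A) (d : Fin n → K) (y : OrdEdge n → K)
    (D : Finset (OrdEdge n)) {B : ℝ} (hB0 : 0 ≤ B)
    (hB : ∀ F ⊆ diagProdFiber T d y, ∀ X₀ ∈ F, (∀ X ∈ F, AgreeOff D X X₀) → (F.card : ℝ) ≤ B) :
    ((diagProdFiber T d y).card : ℝ) ≤ B * ∏ e, if e ∈ D then (1 : ℝ) else mulRep A (y e) := by
  classical
  set φ : Matrix (Fin n) (Fin n) K → OrdEdge n → K × K := fun X e =>
    if e ∈ D then (0, 0) else (X e.1.1 e.1.2, X e.1.2 e.1.1) with hφ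
  set I := (diagProdFiber T d y).image φ with hI
  have h1 : (I.card : ℝ) ≤ ∏ e, if e ∈ D then (1 : ℝ) else mulRep A (y e) := by
    have h2 : I ⊆ Fintype.piFinset fun e => if e ∈ D then {(0, 0)} else
        (A ×ˢ A).filter fun x => x.1 * x.2 = y e := by
      intro z hz
      obtain ⟨X, hX, rfl⟩ := Finset.mem_image.1 hz
      obtain ⟨hX, -, h3⟩ := Finset.mem_filter.1 hX
      refine Fintype.mem_piFinset.2 fun e => ?_
      by_cases he : e ∈ D
      · simp [hφ, he]
      · simp [hφ, he, hT X hX, ← h3, edgeProd]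
    have h3 := Finset.card_le_card h2
    rw [Fintype.card_piFinset] at h3
    refine (Nat.cast_le.2 h3).trans ?_
    rw [Nat.cast_prod]
    refine (Finset.prod_congr rfl fun e _ => ?_).le
    split_ifs <;> simp [mulRep]
  have h2 : ((diagProdFiber T d y).card : ℝ) ≤ B * I.card := by
    rw [Finset.card_eq_sum_card_image φ, ← hI, Nat.cast_sum, mul_comm, ← nsmul_eq_mul]
    refine Finset.sum_le_card_nsmul _ _ _ fun z hz => ?_
    obtain ⟨X₀, hX₀, rfl⟩ := Finset.mem_image.1 hz
    refine hB _ (Finset.filter_subset _ _) X₀ (by simp [hX₀]) fun X hX => ?_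
    obtain ⟨hX, hφX⟩ := Finset.mem_filter.1 hX
    have e1 := (Finset.mem_filter.1 hX).2.1
    have e2 := (Finset.mem_filter.1 hX₀).2.1
    refine ⟨fun i => (congrFun e1 i).trans (congrFun e2 i).symm, fun e he => ?_⟩
    have := congrFun hφX e
    simpa [hφ, he] using this
  exact h2.trans (mul_le_mul_of_nonneg_left h1 hB0)

/-- Two bounds obtained by dropping the edges in `D₁`, respectively `D₂`, combine into a bound
where every edge in `D₁ ∪ D₂` has the weight `√r`. -/
lemma card_diagProdFiber_le_of_two {A : Finset K} {T : Finset (Matrix (Fin n) (Fin n) K)}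
    (hT : ∀ X ∈ T, ∀ i j, X i j ∈ A) (d : Fin n → K) (y : OrdEdge n → K)
    (D₁ D₂ : Finset (OrdEdge n)) {B : ℝ} (hB0 : 0 ≤ B)
    (hB₁ : ∀ F ⊆ diagProdFiber T d y, ∀ X₀ ∈ F, (∀ X ∈ F, AgreeOff D₁ X X₀) → (F.card : ℝ) ≤ B)
    (hB₂ : ∀ F ⊆ diagProdFiber T d y, ∀ X₀ ∈ F, (∀ X ∈ F, AgreeOff D₂ X X₀) → (F.card : ℝ) ≤ B) :
    ((diagProdFiber T d y).card : ℝ) ≤ B * ∏ e, repWeight A (e ∈ D₁ ∪ D₂) (y e) := by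
  have hnn : 0 ≤ B * ∏ e, repWeight A (e ∈ D₁ ∪ D₂) (y e) :=
    mul_nonneg hB0 (Finset.prod_nonneg fun e _ => repWeight_nonneg _ _ _)
  obtain hE | ⟨X₁, hX₁⟩ := (diagProdFiber T d y).eq_empty_or_nonempty
  · simpa [hE] using hnn
  have hr : ∀ e, (1 : ℝ) ≤ mulRep A (y e) := by
    intro e
    obtain ⟨h1, -, h2⟩ := Finset.mem_filter.1 hX₁
    rw [← h2]
    exact_mod_cast one_le_mulRep (hT _ h1 _ _) (hT _ h1 _ _)
  have b1 := card_diagProdFiber_le hT d y D₁ hB0 hB₁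
  have b2 := card_diagProdFiber_le hT d y D₂ hB0 hB₂
  refine (pow_le_pow_iff_left₀ (Nat.cast_nonneg _) hnn two_ne_zero).1 ?_
  calc ((diagProdFiber T d y).card : ℝ) ^ 2
      ≤ (B * ∏ e, if e ∈ D₁ then (1 : ℝ) else mulRep A (y e)) *
        (B * ∏ e, if e ∈ D₂ then (1 : ℝ) else mulRep A (y e)) := by
          rw [sq]
          exact mul_le_mul b1 b2 (by positivity) ((Nat.cast_nonneg _).trans b1)
    _ = B ^ 2 * ∏ e, (if e ∈ D₁ then (1 : ℝ) else mulRep A (y e)) *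
        (if e ∈ D₂ then (1 : ℝ) else mulRep A (y e)) := by
          rw [Finset.prod_mul_distrib]
          ring
    _ ≤ B ^ 2 * ∏ e, repWeight A (e ∈ D₁ ∪ D₂) (y e) ^ 2 := by
          gcongr with e
          have := hr e
          unfold repWeight
          by_cases h1 : e ∈ D₁ <;> by_cases h2 : e ∈ D₂ <;> simp [h1, h2, sq]
          exact_mod_cast this
    _ = (B * ∏ e, repWeight A (e ∈ D₁ ∪ D₂) (y e)) ^ 2 := by
          rw [mul_pow, Finset.prod_pow]

end Edges

section Totals

open scoped Pointwise

universe u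

/-- The summation over the diagonals and over the products of opposite entries. -/
lemma exists_card_le_of_card_diagProdFiber_le (n ρ : ℕ) : ∃ C : ℝ, 0 ≤ C ∧
    ∀ (K : Type u) [Field K] [CharZero K] [DecidableEq K] (S : Fin ρ → Kˣ) (A : Finset K),
      (∀ a ∈ A, ∃ u ∈ divHull S, (u : K) = a) →
      ∀ (T : Finset (Matrix (Fin n) (Fin n) K)), (∀ X ∈ T, ∀ i j, X i j ∈ A) →
      (∀ X ∈ T, ∀ Y ∈ T, X.trace = Y.trace ∧ (X ^ 2).trace = (Y ^ 2).trace) →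
      ∀ (H : Finset (OrdEdge n)) (B : ℝ), 0 ≤ B →
      (∀ d y, ((diagProdFiber T d y).card : ℝ) ≤ B * ∏ e, repWeight A (e ∈ H) (y e)) →
      (T.card : ℝ) ≤ C * B * ((A.card : ℝ) ^ (n / 2 : ℝ) *
        ∏ e, (A.card : ℝ) ^ (if e ∈ H then (1 : ℝ) else 3 / 2)) := by
  obtain ⟨C₁, hC₁, h₁⟩ := exists_sum_prod_le.{u} (Fin n) ρ
  obtain ⟨C₂, hC₂, h₂⟩ := exists_sum_prod_le.{u} (OrdEdge n) ρ
  refine ⟨C₁ * C₂, mul_nonneg hC₁ hC₂, ?_⟩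
  intro K _ _ _ S A hA T hTA hT H B hB hfib
  have hA0 : (0 : K) ∉ A := by
    intro h
    obtain ⟨u, -, hu⟩ := hA 0 h
    exact u.ne_zero hu
  have hAA : ∀ a ∈ A * A, ∃ u ∈ divHull S, (u : K) = a := by
    intro a ha
    obtain ⟨b, hb, c, hc, rfl⟩ := Finset.mem_mul.1 ha
    obtain ⟨u, hu, rfl⟩ := hA b hb
    obtain ⟨v, hv, rfl⟩ := hA c hc
    exact ⟨u * v, mul_mem hu hv, by simp⟩
  obtain rfl | ⟨X₁, hX₁⟩ := T.eq_empty_or_nonempty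
  · simp only [Finset.card_empty, Nat.cast_zero]
    positivity
  set P := (Fintype.piFinset fun _ : Fin n => A).filter fun d => ∑ i, d i = X₁.trace with hP
  set Q : (Fin n → K) → Finset (OrdEdge n → K) := fun d =>
    (Fintype.piFinset fun _ : OrdEdge n => A * A).filter fun y =>
      ∑ e, y e = ((X₁ ^ 2).trace - ∑ i, d i ^ 2) / 2 with hQ
  set R := P.sigma fun d => Q d with hR
  have hmap : ∀ X ∈ T, (⟨fun i => X i i, edgeProd X⟩ : Σ _ : Fin n → K, OrdEdge n → K) ∈ R := by
    intro X hX
    obtain ⟨t1, t2⟩ := hT X hX X₁ hX₁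
    refine Finset.mem_sigma.2 ⟨Finset.mem_filter.2 ⟨?_, t1⟩, Finset.mem_filter.2 ⟨?_, ?_⟩⟩
    · exact Fintype.mem_piFinset.2 fun i => hTA X hX i i
    · exact Fintype.mem_piFinset.2 fun e => Finset.mul_mem_mul (hTA X hX _ _) (hTA X hX _ _)
    · rw [← t2, trace_sq_eq]
      simp
  have hcard : T.card = ∑ x ∈ R, (diagProdFiber T x.1 x.2).card := by
    rw [Finset.card_eq_sum_card_fiberwise (f := fun X : Matrix (Fin n) (Fin n) K =>
      (⟨fun i => X i i, edgeProd X⟩ : Σ _ : Fin n → K, OrdEdge n → K)) (t := R)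
      fun X hX => hmap X hX]
    refine Finset.sum_congr rfl fun x _ => congrArg Finset.card ?_
    obtain ⟨d, y⟩ := x
    simp [diagProdFiber]
  set V : ℝ := ∏ e : OrdEdge n, (A.card : ℝ) ^ (if e ∈ H then (1 : ℝ) else 3 / 2) with hV
  have hV0 : 0 ≤ V := Finset.prod_nonneg fun e _ => by positivity
  have hy : ∀ d, ∑ y ∈ Q d, ∏ e, repWeight A (e ∈ H) (y e) ≤ C₂ * V := by
    intro d
    refine (h₂ K S (A * A) hAA _ (fun e => repWeight A (e ∈ H))
      fun e x => repWeight_nonneg _ _ _).trans ?_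
    refine mul_le_mul_of_nonneg_left ?_ hC₂
    exact Finset.prod_le_prod (fun e _ => Real.sqrt_nonneg _)
      fun e _ => sqrt_sum_repWeight_sq_le hA0 _
  have hd : (P.card : ℝ) ≤ C₁ * (A.card : ℝ) ^ (n / 2 : ℝ) := by
    have := h₁ K S A hA X₁.trace (fun _ _ => 1) fun _ _ => zero_le_one
    simp only [Finset.prod_const_one, Finset.sum_const, nsmul_eq_mul, mul_one, one_pow,
      Finset.prod_const, Finset.card_univ, Fintype.card_fin] at this
    refine this.trans (mul_le_mul_of_nonneg_left ?_ hC₁)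
    rw [Real.sqrt_eq_rpow, ← Real.rpow_natCast, ← Real.rpow_mul (by positivity)]
    exact (congrArg _ (by ring)).le
  calc (T.card : ℝ) = ∑ d ∈ P, ∑ y ∈ Q d, ((diagProdFiber T d y).card : ℝ) := by
        rw [hcard, Nat.cast_sum, hR, Finset.sum_sigma]
    _ ≤ ∑ d ∈ P, B * (C₂ * V) := by
        refine Finset.sum_le_sum fun d _ => ?_
        refine (Finset.sum_le_sum fun y _ => hfib d y).trans ?_
        rw [← Finset.mul_sum]
        exact mul_le_mul_of_nonneg_left (hy d) hB
    _ = P.card * (B * (C₂ * V)) := by rw [Finset.sum_const, nsmul_eq_mul]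
    _ ≤ C₁ * (A.card : ℝ) ^ (n / 2 : ℝ) * (B * (C₂ * V)) :=
        mul_le_mul_of_nonneg_right hd (by positivity)
    _ = _ := by ring

lemma card_ordEdge (n : ℕ) : (Fintype.card (OrdEdge n) : ℝ) = n * (n - 1) / 2 := by
  have := sum_univ_prod_eq_of_symm (K := ℝ) (n := n) (fun _ => 1) fun _ => rfl
  simp at this
  have h2 : (Fintype.card (OrdEdge n) : ℝ) = ((n : ℝ) * n - n) / 2 := by
    rw [this]; simp [OrdEdge, Fintype.card_subtype]
  rw [h2]
  ring

/-- The exponent produced by the summation, when the edges in `H` have the smaller weight. -/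
lemma rpow_mul_prod_rpow_le {n : ℕ} {a : ℝ} (ha : 1 ≤ a) (H : Finset (OrdEdge n)) {s : ℝ}
    (hs : 2 * s ≤ H.card) :
    a ^ (n / 2 : ℝ) * ∏ e, a ^ (if e ∈ H then (1 : ℝ) else 3 / 2) ≤ a ^ (betaExp n - s) := by
  have h0 : 0 < a := by linarith
  rw [← Real.rpow_sum_of_pos h0, ← Real.rpow_add h0]
  refine Real.rpow_le_rpow_of_exponent_le ha ?_
  have h1 : ∀ e : OrdEdge n, (if e ∈ H then (1 : ℝ) else 3 / 2) =
      3 / 2 - (if e ∈ H then 1 / 2 else 0) := by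
    intro e
    split_ifs <;> norm_num
  have h2 : ∑ e : OrdEdge n, (if e ∈ H then (1 : ℝ) else 3 / 2) =
      n * (n - 1) / 2 * (3 / 2) - H.card * (1 / 2) := by
    rw [Finset.sum_congr rfl fun e _ => h1 e, Finset.sum_sub_distrib, ← Finset.sum_filter]
    simp only [Finset.sum_const, nsmul_eq_mul, Finset.card_univ, card_ordEdge]
    simp
  rw [h2, betaExp]
  nlinarith

end Totals

section MidSum

variable {n : ℕ} {K : Type*} [Field K]

/-- The part of the entry `(q, p)` of `X ^ 2` that avoids the entries on the edge `p`, `q` and the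
diagonal. -/
def midSum (X : Matrix (Fin n) (Fin n) K) (p q : Fin n) : K :=
  ∑ k : {k : Fin n // k ≠ p ∧ k ≠ q}, X q k * X k p

lemma sq_apply_eq_midSum {X Z : Matrix (Fin n) (Fin n) K} {p q : Fin n}
    (hZ : Z q p = 0) (h : ∀ k, k ≠ p → k ≠ q → Z q k = X q k ∧ Z k p = X k p) :
    (Z ^ 2) q p = midSum X p q := by
  rw [sq, Matrix.mul_apply, midSum,
    ← Finset.sum_subtype (Finset.univ.filter fun k => k ≠ p ∧ k ≠ q) (by simp)
      (fun k => X q k * X k p), Finset.sum_filter]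
  refine Finset.sum_congr rfl fun k _ => ?_
  by_cases h1 : k = p
  · simp [h1, hZ]
  by_cases h2 : k = q
  · simp [h2, hZ]
  · simp [h1, h2, h k h1 h2]

variable [DecidableEq K]

lemma edgeProd_eq_of_mem_diagProdFiber {T : Finset (Matrix (Fin n) (Fin n) K)} {d : Fin n → K}
    {y : OrdEdge n → K} {X : Matrix (Fin n) (Fin n) K} (hX : X ∈ diagProdFiber T d y)
    {p q : Fin n} (h : p ≠ q) : X p q * X q p = y (edgeOf h) := by
  rw [← edgeProd_edgeOf, (Finset.mem_filter.1 hX).2.2]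

variable [CharZero K]

lemma card_le_two_of_agreeOff {T F : Finset (Matrix (Fin n) (Fin n) K)}
    (hT0 : ∀ X ∈ T, ∀ i j, X i j ≠ 0)
    (hT : ∀ X ∈ T, ∀ Y ∈ T, (X ^ 3).trace = (Y ^ 3).trace)
    {d : Fin n → K} {y : OrdEdge n → K} (hF : F ⊆ diagProdFiber T d y)
    {p q : Fin n} (hpq : p ≠ q) {X₀ : Matrix (Fin n) (Fin n) K} (hX₀ : X₀ ∈ F)
    (h : ∀ X ∈ F, AgreeOff {edgeOf hpq} X X₀) (hm : midSum X₀ p q ≠ 0) : F.card ≤ 2 := by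
  have hFT : F ⊆ T := hF.trans (Finset.filter_subset _ _)
  have hy := edgeProd_eq_of_mem_diagProdFiber (hF hX₀) hpq
  obtain ⟨Z, hZ⟩ : ∃ Z : Matrix (Fin n) (Fin n) K, ∀ i j,
      Z i j = if (i = p ∧ j = q) ∨ (i = q ∧ j = p) then 0 else X₀ i j := ⟨_, fun _ _ => rfl⟩
  refine card_le_two_of_edge (Z := Z) hpq (y := y (edgeOf hpq)) (t := (X₀ ^ 3).trace) ?_ ?_
    (fun X hX => edgeProd_eq_of_mem_diagProdFiber (hF hX) hpq)
    (fun X hX => hT X (hFT hX) X₀ (hFT hX₀)) ?_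
  · rw [← hy]
    exact mul_ne_zero (hT0 _ (hFT hX₀) _ _) (hT0 _ (hFT hX₀) _ _)
  · intro X hX
    refine Matrix.ext fun i j => ?_
    by_cases h1 : i = p ∧ j = q
    · obtain ⟨rfl, rfl⟩ := h1
      simp [hZ, edgeMatrix, hpq, hpq.symm]
    by_cases h2 : i = q ∧ j = p
    · obtain ⟨rfl, rfl⟩ := h2
      simp [hZ, edgeMatrix, hpq, hpq.symm]
    · have e1 : X i j = X₀ i j := by
        refine (h X hX).apply_eq fun hij hmem => ?_
        rcases eq_or_eq_of_edgeOf_eq _ _ (Finset.mem_singleton.1 hmem) with h3 | h3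
        exacts [h1 h3, h2 h3]
      have h1' : ¬ (p = i ∧ q = j) := fun h => h1 ⟨h.1.symm, h.2.symm⟩
      have h2' : ¬ (q = i ∧ p = j) := fun h => h2 ⟨h.1.symm, h.2.symm⟩
      simp [hZ, edgeMatrix, h1, h2, e1, h1', h2']
  · rw [sq_apply_eq_midSum (X := X₀)]
    · exact hm
    · simp [hZ]
    · intro k hk hk'
      simp [hZ, hk, hk', hpq, hpq.symm]

lemma card_le_sixteen_of_agreeOff {T F : Finset (Matrix (Fin n) (Fin n) K)}
    (hT0 : ∀ X ∈ T, ∀ i j, X i j ≠ 0)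
    (hT : ∀ X ∈ T, ∀ Y ∈ T, (X ^ 3).trace = (Y ^ 3).trace)
    (hT' : ∀ X ∈ T, ∀ Y ∈ T, (X ^ 4).trace = (Y ^ 4).trace)
    {d : Fin n → K} {y : OrdEdge n → K} (hF : F ⊆ diagProdFiber T d y)
    {p q r s : Fin n} (hpq : p ≠ q) (hrs : r ≠ s) (hpr : p ≠ r) (hps : p ≠ s) (hqr : q ≠ r)
    (hqs : q ≠ s) {X₀ : Matrix (Fin n) (Fin n) K} (hX₀ : X₀ ∈ F)
    (h : ∀ X ∈ F, AgreeOff {edgeOf hpq, edgeOf hrs} X X₀) (hm : midSum X₀ p q ≠ 0)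
    (hm' : midSum X₀ r s ≠ 0) : F.card ≤ 16 := by
  have hFT : F ⊆ T := hF.trans (Finset.filter_subset _ _)
  have hX0 := hT0 _ (hFT hX₀)
  have hy := edgeProd_eq_of_mem_diagProdFiber (hF hX₀) hpq
  have hy' := edgeProd_eq_of_mem_diagProdFiber (hF hX₀) hrs
  obtain ⟨Z, hZ⟩ : ∃ Z : Matrix (Fin n) (Fin n) K, ∀ i j,
      Z i j = if (i = p ∧ j = q) ∨ (i = q ∧ j = p) ∨ (i = r ∧ j = s) ∨ (i = s ∧ j = r) then 0
        else X₀ i j := ⟨_, fun _ _ => rfl⟩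
  refine card_le_sixteen_of_edges (Z := Z) hpq hrs hpr hps hqr hqs (y := y (edgeOf hpq))
    (y' := y (edgeOf hrs)) (t := (X₀ ^ 3).trace) (t' := (X₀ ^ 4).trace) ?_ ?_ ?_
    (fun X hX => edgeProd_eq_of_mem_diagProdFiber (hF hX) hpq)
    (fun X hX => edgeProd_eq_of_mem_diagProdFiber (hF hX) hrs)
    (fun X hX => hT X (hFT hX) X₀ (hFT hX₀)) (fun X hX => hT' X (hFT hX) X₀ (hFT hX₀))
    ?_ ?_ ?_ ?_ ?_ ?_
  · rw [← hy]
    exact mul_ne_zero (hX0 _ _) (hX0 _ _)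
  · rw [← hy']
    exact mul_ne_zero (hX0 _ _) (hX0 _ _)
  · intro X hX
    refine Matrix.ext fun i j => ?_
    by_cases h1 : i = p ∧ j = q
    · obtain ⟨rfl, rfl⟩ := h1
      simp [hZ, edgeMatrix, hpq.symm, hpr.symm, hps.symm]
    by_cases h2 : i = q ∧ j = p
    · obtain ⟨rfl, rfl⟩ := h2
      simp [hZ, edgeMatrix, hpq, hqr.symm, hqs.symm]
    by_cases h3 : i = r ∧ j = s
    · obtain ⟨rfl, rfl⟩ := h3
      simp [hZ, edgeMatrix, hrs.symm, hpr, hqr]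
    by_cases h4 : i = s ∧ j = r
    · obtain ⟨rfl, rfl⟩ := h4
      simp [hZ, edgeMatrix, hrs, hps, hqs]
    · have e1 : X i j = X₀ i j := by
        refine (h X hX).apply_eq fun hij hmem => ?_
        rcases Finset.mem_insert.1 hmem with hmem | hmem
        · rcases eq_or_eq_of_edgeOf_eq _ _ hmem with h5 | h5
          exacts [h1 h5, h2 h5]
        · rcases eq_or_eq_of_edgeOf_eq _ _ (Finset.mem_singleton.1 hmem) with h5 | h5
          exacts [h3 h5, h4 h5]
      have h1' : ¬ (p = i ∧ q = j) := fun h => h1 ⟨h.1.symm, h.2.symm⟩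
      have h2' : ¬ (q = i ∧ p = j) := fun h => h2 ⟨h.1.symm, h.2.symm⟩
      have h3' : ¬ (r = i ∧ s = j) := fun h => h3 ⟨h.1.symm, h.2.symm⟩
      have h4' : ¬ (s = i ∧ r = j) := fun h => h4 ⟨h.1.symm, h.2.symm⟩
      simp [hZ, edgeMatrix, h1, h2, h3, h4, e1, h1', h2', h3', h4']
  · rw [sq_apply_eq_midSum (X := X₀)]
    · exact hm
    · simp [hZ]
    · intro k hk hk'
      simp [hZ, hk, hk', hpq, hpq.symm, hpr, hps, hqr, hqs]
  · rw [sq_apply_eq_midSum (X := X₀)]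
    · exact hm'
    · simp [hZ]
    · intro k hk hk'
      simp [hZ, hk, hk', hrs, hrs.symm, hpr.symm, hps.symm, hqr.symm, hqs.symm]
  · simpa [hZ, hpq, hpq.symm, hpr, hpr.symm, hps, hqr, hqs, hrs, hqr.symm] using hX0 q r
  · simpa [hZ, hpq, hpq.symm, hpr, hpr.symm, hps, hqr, hqs, hrs, hqr.symm, hps.symm, hqs.symm]
      using hX0 s p
  · simpa [hZ, hpq, hpq.symm, hpr, hpr.symm, hps, hqr, hqs, hrs, hqr.symm] using hX0 p r
  · simpa [hZ, hpq, hpq.symm, hpr, hpr.symm, hps, hqr, hqs, hrs, hqr.symm, hps.symm, hqs.symm]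
      using hX0 s q

end MidSum

section Degenerate

open scoped Pointwise

universe u

/-- The edges from `p` to a vertex other than `q`. -/
def starEdges {n : ℕ} (p q : Fin n) : Finset (OrdEdge n) :=
  Finset.univ.image fun k : {k : Fin n // k ≠ p ∧ k ≠ q} => edgeOf k.2.1.symm

lemma edgeOf_injective {n : ℕ} (p q : Fin n) :
    Function.Injective fun k : {k : Fin n // k ≠ p ∧ k ≠ q} => edgeOf k.2.1.symm := by
  intro k l h
  rcases eq_or_eq_of_edgeOf_eq _ _ h with h1 | h1
  · exact Subtype.ext h1.2
  · exact absurd h1.2 k.2.1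

lemma card_starEdges {n : ℕ} {p q : Fin n} (hpq : p ≠ q) : (starEdges p q).card + 2 = n := by
  rw [starEdges, Finset.card_image_of_injective _ (edgeOf_injective p q), Finset.card_univ,
    Fintype.card_subtype]
  have h : (Finset.univ.filter fun k => k ≠ p ∧ k ≠ q) = ({p, q} : Finset (Fin n))ᶜ := by
    ext k
    simp
  have h2 := Finset.card_add_card_compl ({p, q} : Finset (Fin n))
  rw [Finset.card_pair hpq, Fintype.card_fin] at h2
  rw [h]
  omega

lemma exists_card_diagProdFiber_le_of_midSum_eq_zero {n : ℕ} (ρ : ℕ) {p q : Fin n} (hpq : p ≠ q) :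
    ∃ C : ℝ, 0 ≤ C ∧
    ∀ (K : Type u) [Field K] [CharZero K] [DecidableEq K] (S : Fin ρ → Kˣ) (A : Finset K),
      (∀ a ∈ A, ∃ u ∈ divHull S, (u : K) = a) →
      ∀ (T : Finset (Matrix (Fin n) (Fin n) K)), (∀ X ∈ T, ∀ i j, X i j ∈ A) →
      (∀ X ∈ T, midSum X p q = 0) → ∀ d y,
      ((diagProdFiber T d y).card : ℝ) ≤ C * ∏ e, repWeight A (e ∈ starEdges p q) (y e) := by
  obtain ⟨C, hC, hsum⟩ := exists_sum_prod_le.{u} {k : Fin n // k ≠ p ∧ k ≠ q} ρ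
  refine ⟨C, hC, ?_⟩
  intro K _ _ _ S A hA T hTA hT d y
  have hA0 : ∀ a ∈ A, a ≠ 0 := by
    intro a ha
    obtain ⟨u, -, rfl⟩ := hA a ha
    exact u.ne_zero
  have hAA : ∀ a ∈ A * A, ∃ u ∈ divHull S, (u : K) = a := by
    intro a ha
    obtain ⟨b, hb, c, hc, rfl⟩ := Finset.mem_mul.1 ha
    obtain ⟨u, hu, rfl⟩ := hA b hb
    obtain ⟨v, hv, rfl⟩ := hA c hc
    exact ⟨u * v, mul_mem hu hv, by simp⟩
  set ι := {k : Fin n // k ≠ p ∧ k ≠ q} with hι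
  set ed : ι → OrdEdge n := fun k => edgeOf k.2.1.symm with hed
  have key := card_diagProdFiber_le hTA d y (starEdges p q)
    (B := C * ∏ k : ι, √(mulRep A (y (ed k))))
    (mul_nonneg hC (Finset.prod_nonneg fun _ _ => Real.sqrt_nonneg _)) ?_
  · refine key.trans (le_of_eq ?_)
    have h1 : ∏ k : ι, √(mulRep A (y (ed k)) : ℝ) =
        ∏ e, if e ∈ starEdges p q then √(mulRep A (y e) : ℝ) else 1 := by
      rw [← Finset.prod_filter, Finset.filter_univ_mem, starEdges,
        Finset.prod_image fun k _ l _ h => edgeOf_injective p q h]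
    rw [h1, mul_assoc, ← Finset.prod_mul_distrib]
    congr 1
    refine Finset.prod_congr rfl fun e _ => ?_
    unfold repWeight
    split_ifs <;> simp
  · intro F hF X₀ hX₀ hagree
    have hFT : F ⊆ T := hF.trans (Finset.filter_subset _ _)
    have hX0 : ∀ X ∈ F, ∀ i j, X i j ≠ 0 := fun X hX i j => hA0 _ (hTA X (hFT hX) i j)
    have hrow : ∀ X ∈ F, ∀ i j, i ≠ p → j ≠ p → X i j = X₀ i j := by
      intro X hX i j hi hj
      refine (hagree X hX).apply_eq fun hij hmem => ?_
      obtain ⟨k, -, hk⟩ := Finset.mem_image.1 hmem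
      rcases eq_or_eq_of_edgeOf_eq _ _ hk with h1 | h1
      exacts [hi h1.1.symm, hj h1.1.symm]
    have hprod : ∀ X ∈ F, ∀ k : ι, X p k * X k p = y (ed k) := fun X hX k =>
      edgeProd_eq_of_mem_diagProdFiber (hF hX) _
    have hpq' : ∀ X ∈ F, X p q = X₀ p q ∧ X q p = X₀ q p := by
      intro X hX
      have hne : ∀ k : ι, k.1 ≠ q := fun k => k.2.2
      constructor
      · refine (hagree X hX).apply_eq fun hij hmem => ?_
        obtain ⟨k, -, hk⟩ := Finset.mem_image.1 hmem
        rcases eq_or_eq_of_edgeOf_eq _ _ hk with h1 | h1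
        exacts [hne k h1.2, hpq h1.1]
      · refine (hagree X hX).apply_eq fun hij hmem => ?_
        obtain ⟨k, -, hk⟩ := Finset.mem_image.1 hmem
        rcases eq_or_eq_of_edgeOf_eq _ _ hk with h1 | h1
        exacts [hpq h1.1, hne k h1.2]
    set w : ι → K → ℝ := fun k z =>
      if ∃ a ∈ A, (∃ b ∈ A, b * a = y (ed k)) ∧ z = X₀ q k * a then 1 else 0 with hw
    have hw0 : ∀ k z, 0 ≤ w k z := by
      intro k z
      simp only [hw]
      split_ifs <;> norm_num
    set Φ : Matrix (Fin n) (Fin n) K → ι → K := fun X k => X q k * X k p with hΦ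
    have hinj : Set.InjOn Φ F := by
      intro X hX Y hY hXY
      have hcol : ∀ k : ι, X k p = Y k p := by
        intro k
        have h1 : X q k * X k p = Y q k * Y k p := congrFun hXY k
        rw [hrow X hX q k hpq.symm k.2.1, hrow Y hY q k hpq.symm k.2.1] at h1
        exact mul_left_cancel₀ (hX0 X₀ hX₀ _ _) h1
      have hrowp : ∀ k : ι, X p k = Y p k := by
        intro k
        have h1 := (hprod X hX k).trans (hprod Y hY k).symm
        rw [hcol k] at h1
        exact mul_right_cancel₀ (hX0 Y hY _ _) h1
      refine Matrix.ext fun i j => ?_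
      by_cases hi : i = p
      · by_cases hj : j = p
        · rw [hi, hj, (hagree X hX).1, (hagree Y hY).1]
        by_cases hjq : j = q
        · rw [hi, hjq, (hpq' X hX).1, (hpq' Y hY).1]
        · rw [hi]
          exact hrowp ⟨j, hj, hjq⟩
      by_cases hj : j = p
      · by_cases hiq : i = q
        · rw [hj, hiq, (hpq' X hX).2, (hpq' Y hY).2]
        · rw [hj]
          exact hcol ⟨i, hi, hiq⟩
      · rw [hrow X hX i j hi hj, hrow Y hY i j hi hj]
    have hbound := hsum K S (A * A) hAA 0 w hw0
    refine le_trans ?_ (hbound.trans (mul_le_mul_of_nonneg_left ?_ hC))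
    · rw [← Finset.card_image_of_injOn hinj, Finset.card_eq_sum_ones, Nat.cast_sum]
      have hone : ∀ x ∈ F.image Φ, ((1 : ℕ) : ℝ) = ∏ k, w k (x k) := by
        intro x hx
        obtain ⟨X, hX, rfl⟩ := Finset.mem_image.1 hx
        symm
        rw [Nat.cast_one]
        refine Finset.prod_eq_one fun k _ => if_pos ⟨X k p, hTA X (hFT hX) _ _, ?_, ?_⟩
        · exact ⟨X p k, hTA X (hFT hX) _ _, hprod X hX k⟩
        · simp only [hΦ]
          rw [hrow X hX q k hpq.symm k.2.1]
      rw [Finset.sum_congr rfl hone]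
      refine Finset.sum_le_sum_of_subset_of_nonneg ?_
        fun x _ _ => Finset.prod_nonneg fun k _ => hw0 k _
      intro x hx
      obtain ⟨X, hX, rfl⟩ := Finset.mem_image.1 hx
      refine Finset.mem_filter.2 ⟨Fintype.mem_piFinset.2 fun k => ?_, hT X (hFT hX)⟩
      exact Finset.mul_mem_mul (hTA X (hFT hX) _ _) (hTA X (hFT hX) _ _)
    · refine Finset.prod_le_prod (fun k _ => Real.sqrt_nonneg _) fun k _ => ?_
      apply Real.sqrt_le_sqrt
      simp only [hw, ite_pow, one_pow, zero_pow two_ne_zero]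
      rw [Finset.sum_boole]
      refine Nat.cast_le.2 ?_
      refine (Finset.card_le_card (t := ((A ×ˢ A).filter fun x => x.1 * x.2 = y (ed k)).image
        fun x => X₀ q k * x.2) ?_).trans Finset.card_image_le
      intro z hz
      obtain ⟨-, a, ha, ⟨b, hb, hab⟩, rfl⟩ := Finset.mem_filter.1 hz
      exact Finset.mem_image.2 ⟨(b, a), by simp [ha, hb, hab], rfl⟩

end Degenerate

section CountMatrices

universe u

lemma exists_card_le_of_midSum_eq_zero {n : ℕ} (ρ : ℕ) {p q : Fin n} (hpq : p ≠ q) {s : ℝ}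
    (hs : 2 * s ≤ n - 2) : ∃ C : ℝ, 0 ≤ C ∧
    ∀ (K : Type u) [Field K] [CharZero K] [DecidableEq K] (S : Fin ρ → Kˣ) (A : Finset K),
      (∀ a ∈ A, ∃ u ∈ divHull S, (u : K) = a) → A.Nonempty →
      ∀ (T : Finset (Matrix (Fin n) (Fin n) K)), (∀ X ∈ T, ∀ i j, X i j ∈ A) →
      (∀ X ∈ T, ∀ Y ∈ T, X.trace = Y.trace ∧ (X ^ 2).trace = (Y ^ 2).trace) →
      (∀ X ∈ T, midSum X p q = 0) → (T.card : ℝ) ≤ C * (A.card : ℝ) ^ (betaExp n - s) := by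
  obtain ⟨C₁, hC₁, h₁⟩ := exists_card_le_of_card_diagProdFiber_le.{u} n ρ
  obtain ⟨C₂, hC₂, h₂⟩ := exists_card_diagProdFiber_le_of_midSum_eq_zero.{u} ρ hpq
  refine ⟨C₁ * C₂, mul_nonneg hC₁ hC₂, ?_⟩
  intro K _ _ _ S A hA hne T hTA hT hm
  refine (h₁ K S A hA T hTA hT (starEdges p q) C₂ hC₂ (h₂ K S A hA T hTA hm)).trans ?_
  refine mul_le_mul_of_nonneg_left (rpow_mul_prod_rpow_le ?_ _ ?_) (mul_nonneg hC₁ hC₂)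
  · exact_mod_cast hne.card_pos
  · have : ((starEdges p q).card : ℝ) + 2 = n := by exact_mod_cast card_starEdges hpq
    linarith

/-- The bound when two sets of edges can be dropped at a bounded cost. -/
lemma exists_card_le_of_two (n ρ : ℕ) (s : ℝ) : ∃ C : ℝ, 0 ≤ C ∧
    ∀ (K : Type u) [Field K] [CharZero K] [DecidableEq K] (S : Fin ρ → Kˣ) (A : Finset K),
      (∀ a ∈ A, ∃ u ∈ divHull S, (u : K) = a) → A.Nonempty →
      ∀ (T : Finset (Matrix (Fin n) (Fin n) K)), (∀ X ∈ T, ∀ i j, X i j ∈ A) →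
      (∀ X ∈ T, ∀ Y ∈ T, X.trace = Y.trace ∧ (X ^ 2).trace = (Y ^ 2).trace) →
      ∀ D₁ D₂ : Finset (OrdEdge n), 2 * s ≤ (D₁ ∪ D₂).card →
      (∀ D, D = D₁ ∨ D = D₂ → ∀ d y, ∀ F ⊆ diagProdFiber T d y, ∀ X₀ ∈ F,
        (∀ X ∈ F, AgreeOff D X X₀) → F.card ≤ 16) →
      (T.card : ℝ) ≤ C * (A.card : ℝ) ^ (betaExp n - s) := by
  obtain ⟨C₁, hC₁, h₁⟩ := exists_card_le_of_card_diagProdFiber_le.{u} n ρ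
  refine ⟨C₁ * 16, by positivity, ?_⟩
  intro K _ _ _ S A hA hne T hTA hT D₁ D₂ hs hD
  refine (h₁ K S A hA T hTA hT (D₁ ∪ D₂) 16 (by norm_num) fun d y => ?_).trans ?_
  · exact card_diagProdFiber_le_of_two hTA d y D₁ D₂ (by norm_num)
      (fun F hF X₀ hX₀ h => by exact_mod_cast hD D₁ (Or.inl rfl) d y F hF X₀ hX₀ h)
      (fun F hF X₀ hX₀ h => by exact_mod_cast hD D₂ (Or.inr rfl) d y F hF X₀ hX₀ h)
  · refine mul_le_mul_of_nonneg_left (rpow_mul_prod_rpow_le ?_ _ hs) (by positivity)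
    exact_mod_cast hne.card_pos

lemma edgeOf_ne_edgeOf {n : ℕ} {i j k l : Fin n} (h : i ≠ j) (h' : k ≠ l)
    (h1 : i ≠ k ∨ j ≠ l) (h2 : i ≠ l ∨ j ≠ k) : edgeOf h ≠ edgeOf h' := by
  intro he
  rcases eq_or_eq_of_edgeOf_eq h h' he with h3 | h3
  · exact h1.elim (fun h => h h3.1) fun h => h h3.2
  · exact h2.elim (fun h => h h3.1) fun h => h h3.2

variable {K : Type u} [Field K] [DecidableEq K]

/-- `T` has a common value of the traces of the first four powers. -/
def SameTraces {n : ℕ} (T : Finset (Matrix (Fin n) (Fin n) K)) : Prop :=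
  ∀ X ∈ T, ∀ Y ∈ T, (X.trace = Y.trace ∧ (X ^ 2).trace = (Y ^ 2).trace) ∧
    (X ^ 3).trace = (Y ^ 3).trace ∧ (X ^ 4).trace = (Y ^ 4).trace

omit [DecidableEq K] in
lemma SameTraces.subset {n : ℕ} {T T' : Finset (Matrix (Fin n) (Fin n) K)} (h : SameTraces T)
    (hT : T' ⊆ T) : SameTraces T' := fun X hX Y hY => h X (hT hX) Y (hT hY)

lemma exists_card_le_of_five_le {n : ℕ} (ρ : ℕ) (hn : 5 ≤ n) : ∃ C : ℝ, 0 ≤ C ∧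
    ∀ (K : Type u) [Field K] [CharZero K] [DecidableEq K] (S : Fin ρ → Kˣ) (A : Finset K),
      (∀ a ∈ A, ∃ u ∈ divHull S, (u : K) = a) → A.Nonempty →
      ∀ (T : Finset (Matrix (Fin n) (Fin n) K)), (∀ X ∈ T, ∀ i j, X i j ∈ A) → SameTraces T →
      (T.card : ℝ) ≤ C * (A.card : ℝ) ^ (betaExp n - 3 / 2) := by
  obtain ⟨v, hv⟩ : ∃ v : Fin 5 → Fin n, Function.Injective v :=
    ⟨Fin.castLE hn, Fin.castLE_injective hn⟩
  have hne : ∀ i j : Fin 5, i ≠ j → v i ≠ v j := fun i j h => hv.ne h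
  have h01 := hne 0 1 (by decide)
  have h02 := hne 0 2 (by decide)
  have h34 := hne 3 4 (by decide)
  have h12 := hne 1 2 (by decide)
  have h03 := hne 0 3 (by decide)
  have h04 := hne 0 4 (by decide)
  have h13 := hne 1 3 (by decide)
  have h14 := hne 1 4 (by decide)
  have h23 := hne 2 3 (by decide)
  have h24 := hne 2 4 (by decide)
  have hn' : (5 : ℝ) ≤ n := by exact_mod_cast hn
  have hs : 2 * (3 / 2 : ℝ) ≤ n - 2 := by linarith
  obtain ⟨C₁, hC₁, b₁⟩ := exists_card_le_of_midSum_eq_zero.{u} ρ h01 hs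
  obtain ⟨C₂, hC₂, b₂⟩ := exists_card_le_of_midSum_eq_zero.{u} ρ h02 hs
  obtain ⟨C₃, hC₃, b₃⟩ := exists_card_le_of_midSum_eq_zero.{u} ρ h34 hs
  obtain ⟨C₄, hC₄, b₄⟩ := exists_card_le_of_two.{u} n ρ (3 / 2)
  refine ⟨C₁ + C₂ + C₃ + C₄, by positivity, ?_⟩
  intro K _ _ _ S A hA hAne T hTA hT
  have hA0 : ∀ a ∈ A, a ≠ 0 := by
    intro a ha
    obtain ⟨u, -, rfl⟩ := hA a ha
    exact u.ne_zero
  set T₁ := T.filter fun X => midSum X (v 0) (v 1) = 0 with hT₁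
  set T₂ := T.filter fun X => midSum X (v 0) (v 2) = 0 with hT₂
  set T₃ := T.filter fun X => midSum X (v 3) (v 4) = 0 with hT₃
  set T₄ := T.filter fun X => midSum X (v 0) (v 1) ≠ 0 ∧ midSum X (v 0) (v 2) ≠ 0 ∧
    midSum X (v 3) (v 4) ≠ 0 with hT₄
  have hcov : T ⊆ T₁ ∪ T₂ ∪ T₃ ∪ T₄ := by
    intro X hX
    simp only [hT₁, hT₂, hT₃, hT₄, Finset.mem_union, Finset.mem_filter, hX, true_and]
    tauto
  have hcard : (T.card : ℝ) ≤ T₁.card + T₂.card + T₃.card + T₄.card := by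
    have h1 := Finset.card_le_card hcov
    have h2 := Finset.card_union_le (T₁ ∪ T₂ ∪ T₃) T₄
    have h3 := Finset.card_union_le (T₁ ∪ T₂) T₃
    have h4 := Finset.card_union_le T₁ T₂
    exact_mod_cast (by omega : T.card ≤ T₁.card + T₂.card + T₃.card + T₄.card)
  have s₁ : T₁ ⊆ T := Finset.filter_subset _ _
  have s₂ : T₂ ⊆ T := Finset.filter_subset _ _
  have s₃ : T₃ ⊆ T := Finset.filter_subset _ _
  have s₄ : T₄ ⊆ T := Finset.filter_subset _ _
  have c₁ := b₁ K S A hA hAne T₁ (fun X hX => hTA X (s₁ hX))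
    (fun X hX Y hY => (hT X (s₁ hX) Y (s₁ hY)).1) fun X hX => (Finset.mem_filter.1 hX).2
  have c₂ := b₂ K S A hA hAne T₂ (fun X hX => hTA X (s₂ hX))
    (fun X hX Y hY => (hT X (s₂ hX) Y (s₂ hY)).1) fun X hX => (Finset.mem_filter.1 hX).2
  have c₃ := b₃ K S A hA hAne T₃ (fun X hX => hTA X (s₃ hX))
    (fun X hX Y hY => (hT X (s₃ hX) Y (s₃ hY)).1) fun X hX => (Finset.mem_filter.1 hX).2
  have c₄ := b₄ K S A hA hAne T₄ (fun X hX => hTA X (s₄ hX))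
    (fun X hX Y hY => (hT X (s₄ hX) Y (s₄ hY)).1)
    {edgeOf h01, edgeOf h34} {edgeOf h02, edgeOf h34} ?_ ?_
  · calc (T.card : ℝ) ≤ T₁.card + T₂.card + T₃.card + T₄.card := hcard
      _ ≤ _ := by linarith
  · have h3 : ({edgeOf h01, edgeOf h02, edgeOf h34} : Finset (OrdEdge n)).card = 3 := by
      rw [Finset.card_eq_three]
      exact ⟨_, _, _, edgeOf_ne_edgeOf _ _ (Or.inr h12) (Or.inl h02),
        edgeOf_ne_edgeOf _ _ (Or.inl h03) (Or.inl h04),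
        edgeOf_ne_edgeOf _ _ (Or.inl h03) (Or.inl h04), rfl⟩
    have h4 : ({edgeOf h01, edgeOf h34} ∪ {edgeOf h02, edgeOf h34} : Finset (OrdEdge n)) =
        {edgeOf h01, edgeOf h02, edgeOf h34} := by
      ext e
      simp only [Finset.mem_union, Finset.mem_insert, Finset.mem_singleton]
      tauto
    rw [h4, h3]
    norm_num
  · intro D hD d y F hF X₀ hX₀ hagree
    obtain ⟨-, m1, m2, m3⟩ := Finset.mem_filter.1 (Finset.mem_filter.1 (hF hX₀)).1
    have z : ∀ X ∈ T₄, ∀ i j, X i j ≠ 0 := fun X hX i j => hA0 _ (hTA X (s₄ hX) i j)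
    have t3 : ∀ X ∈ T₄, ∀ Y ∈ T₄, (X ^ 3).trace = (Y ^ 3).trace :=
      fun X hX Y hY => (hT X (s₄ hX) Y (s₄ hY)).2.1
    have t4 : ∀ X ∈ T₄, ∀ Y ∈ T₄, (X ^ 4).trace = (Y ^ 4).trace :=
      fun X hX Y hY => (hT X (s₄ hX) Y (s₄ hY)).2.2
    rcases hD with rfl | rfl
    · exact card_le_sixteen_of_agreeOff z t3 t4 hF h01 h34 h03 h04 h13 h14 hX₀ hagree m1 m3
    · exact card_le_sixteen_of_agreeOff z t3 t4 hF h02 h34 h03 h04 h23 h24 hX₀ hagree m2 m3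

/-- The bound when the vanishing of the sums `midSum` is under control. -/
lemma exists_card_le_of_midSum_ne_zero {n : ℕ} (ρ : ℕ) {p q r : Fin n} (hpq : p ≠ q) (hpr : p ≠ r)
    (hqr : q ≠ r) : ∃ C : ℝ, 0 ≤ C ∧
    ∀ (K : Type u) [Field K] [CharZero K] [DecidableEq K] (S : Fin ρ → Kˣ) (A : Finset K),
      (∀ a ∈ A, ∃ u ∈ divHull S, (u : K) = a) → A.Nonempty →
      ∀ (T : Finset (Matrix (Fin n) (Fin n) K)), (∀ X ∈ T, ∀ i j, X i j ∈ A) → SameTraces T →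
      (∀ X ∈ T, midSum X p q ≠ 0 ∧ midSum X p r ≠ 0) →
      (T.card : ℝ) ≤ C * (A.card : ℝ) ^ (betaExp n - 1) := by
  obtain ⟨C, hC, b⟩ := exists_card_le_of_two.{u} n ρ 1
  refine ⟨C, hC, ?_⟩
  intro K _ _ _ S A hA hAne T hTA hT hm
  have hA0 : ∀ a ∈ A, a ≠ 0 := by
    intro a ha
    obtain ⟨u, -, rfl⟩ := hA a ha
    exact u.ne_zero
  refine b K S A hA hAne T hTA (fun X hX Y hY => (hT X hX Y hY).1) {edgeOf hpq} {edgeOf hpr} ?_ ?_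
  · have h1 : ({edgeOf hpq} ∪ {edgeOf hpr} : Finset (OrdEdge n)).card = 2 :=
      Finset.card_pair (edgeOf_ne_edgeOf _ _ (Or.inr hqr) (Or.inl hpr))
    rw [h1]
    norm_num
  · intro D hD d y F hF X₀ hX₀ hagree
    obtain ⟨m1, m2⟩ := hm X₀ (Finset.mem_filter.1 (hF hX₀)).1
    have z : ∀ X ∈ T, ∀ i j, X i j ≠ 0 := fun X hX i j => hA0 _ (hTA X hX i j)
    have t3 : ∀ X ∈ T, ∀ Y ∈ T, (X ^ 3).trace = (Y ^ 3).trace :=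
      fun X hX Y hY => (hT X hX Y hY).2.1
    rcases hD with rfl | rfl
    · exact (card_le_two_of_agreeOff z t3 hF hpq hX₀ hagree m1).trans (by norm_num)
    · exact (card_le_two_of_agreeOff z t3 hF hpr hX₀ hagree m2).trans (by norm_num)

lemma exists_card_le_of_eq_three (ρ : ℕ) : ∃ C : ℝ, 0 ≤ C ∧
    ∀ (K : Type u) [Field K] [CharZero K] [DecidableEq K] (S : Fin ρ → Kˣ) (A : Finset K),
      (∀ a ∈ A, ∃ u ∈ divHull S, (u : K) = a) → A.Nonempty →
      ∀ (T : Finset (Matrix (Fin 3) (Fin 3) K)), (∀ X ∈ T, ∀ i j, X i j ∈ A) → SameTraces T →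
      (T.card : ℝ) ≤ C * (A.card : ℝ) ^ (betaExp 3 - 1) := by
  obtain ⟨C, hC, b⟩ := exists_card_le_of_midSum_ne_zero.{u} (n := 3) ρ (p := 0) (q := 1) (r := 2)
    (by decide) (by decide) (by decide)
  refine ⟨C, hC, ?_⟩
  intro K _ _ _ S A hA hAne T hTA hT
  refine b K S A hA hAne T hTA hT fun X hX => ?_
  have hX0 : ∀ i j, X i j ≠ 0 := by
    intro i j
    obtain ⟨u, -, hu⟩ := hA _ (hTA X hX i j)
    rw [← hu]
    exact u.ne_zero
  have h1 : midSum X 0 1 = X 1 2 * X 2 0 := by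
    rw [midSum, ← Finset.sum_subtype (Finset.univ.filter fun k : Fin 3 => k ≠ 0 ∧ k ≠ 1) (by simp)
      (fun k => X 1 k * X k 0), Finset.sum_filter, Fin.sum_univ_three]
    simp
  have h2 : midSum X 0 2 = X 2 1 * X 1 0 := by
    rw [midSum, ← Finset.sum_subtype (Finset.univ.filter fun k : Fin 3 => k ≠ 0 ∧ k ≠ 2) (by simp)
      (fun k => X 2 k * X k 0), Finset.sum_filter, Fin.sum_univ_three]
    simp
  rw [h1, h2]
  exact ⟨mul_ne_zero (hX0 _ _) (hX0 _ _), mul_ne_zero (hX0 _ _) (hX0 _ _)⟩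

lemma exists_card_le_of_four_le {n : ℕ} (ρ : ℕ) (hn : 4 ≤ n) : ∃ C : ℝ, 0 ≤ C ∧
    ∀ (K : Type u) [Field K] [CharZero K] [DecidableEq K] (S : Fin ρ → Kˣ) (A : Finset K),
      (∀ a ∈ A, ∃ u ∈ divHull S, (u : K) = a) → A.Nonempty →
      ∀ (T : Finset (Matrix (Fin n) (Fin n) K)), (∀ X ∈ T, ∀ i j, X i j ∈ A) → SameTraces T →
      (T.card : ℝ) ≤ C * (A.card : ℝ) ^ (betaExp n - 1) := by
  have hv := Fin.castLE_injective hn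
  have h01 : Fin.castLE hn 0 ≠ Fin.castLE hn 1 := hv.ne (by decide)
  have h02 : Fin.castLE hn 0 ≠ Fin.castLE hn 2 := hv.ne (by decide)
  have h12 : Fin.castLE hn 1 ≠ Fin.castLE hn 2 := hv.ne (by decide)
  have hn' : (4 : ℝ) ≤ n := by exact_mod_cast hn
  have hs : 2 * (1 : ℝ) ≤ n - 2 := by linarith
  obtain ⟨C₁, hC₁, b₁⟩ := exists_card_le_of_midSum_eq_zero.{u} ρ h01 hs
  obtain ⟨C₂, hC₂, b₂⟩ := exists_card_le_of_midSum_eq_zero.{u} ρ h02 hs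
  obtain ⟨C₃, hC₃, b₃⟩ := exists_card_le_of_midSum_ne_zero.{u} ρ h01 h02 h12
  refine ⟨C₁ + C₂ + C₃, by positivity, ?_⟩
  intro K _ _ _ S A hA hAne T hTA hT
  generalize Fin.castLE hn 0 = p at *
  generalize Fin.castLE hn 1 = q at *
  generalize Fin.castLE hn 2 = r at *
  set T₁ := T.filter fun X => midSum X p q = 0 with hT₁
  set T₂ := T.filter fun X => midSum X p r = 0 with hT₂
  set T₃ := T.filter fun X => midSum X p q ≠ 0 ∧ midSum X p r ≠ 0 with hT₃
  have hcov : T ⊆ T₁ ∪ T₂ ∪ T₃ := by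
    intro X hX
    simp only [hT₁, hT₂, hT₃, Finset.mem_union, Finset.mem_filter, hX, true_and]
    tauto
  have hcard : (T.card : ℝ) ≤ T₁.card + T₂.card + T₃.card := by
    have h1 := Finset.card_le_card hcov
    have h3 := Finset.card_union_le (T₁ ∪ T₂) T₃
    have h4 := Finset.card_union_le T₁ T₂
    exact_mod_cast (by omega : T.card ≤ T₁.card + T₂.card + T₃.card)
  have s₁ : T₁ ⊆ T := Finset.filter_subset _ _
  have s₂ : T₂ ⊆ T := Finset.filter_subset _ _
  have s₃ : T₃ ⊆ T := Finset.filter_subset _ _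
  have c₁ := b₁ K S A hA hAne T₁ (fun X hX => hTA X (s₁ hX))
    (fun X hX Y hY => (hT X (s₁ hX) Y (s₁ hY)).1) fun X hX => (Finset.mem_filter.1 hX).2
  have c₂ := b₂ K S A hA hAne T₂ (fun X hX => hTA X (s₂ hX))
    (fun X hX Y hY => (hT X (s₂ hX) Y (s₂ hY)).1) fun X hX => (Finset.mem_filter.1 hX).2
  have c₃ := b₃ K S A hA hAne T₃ (fun X hX => hTA X (s₃ hX)) (hT.subset s₃)
    fun X hX => (Finset.mem_filter.1 hX).2
  linarith

lemma exists_card_le_of_three_le {n : ℕ} (ρ : ℕ) (hn : 3 ≤ n) : ∃ C : ℝ, 0 ≤ C ∧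
    ∀ (K : Type u) [Field K] [CharZero K] [DecidableEq K] (S : Fin ρ → Kˣ) (A : Finset K),
      (∀ a ∈ A, ∃ u ∈ divHull S, (u : K) = a) → A.Nonempty →
      ∀ (T : Finset (Matrix (Fin n) (Fin n) K)), (∀ X ∈ T, ∀ i j, X i j ∈ A) → SameTraces T →
      (T.card : ℝ) ≤ C * (A.card : ℝ) ^ (betaExp n - if n ≤ 4 then 1 else 3 / 2) := by
  split_ifs with h
  · obtain rfl | h4 := hn.eq_or_lt
    · exact exists_card_le_of_eq_three ρ
    · exact exists_card_le_of_four_le ρ h4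
  · exact exists_card_le_of_five_le ρ (by omega)

omit [DecidableEq K] in
lemma sameTraces_of_charpoly_eq {n : ℕ} {T : Finset (Matrix (Fin n) (Fin n) K)}
    {f : Polynomial K} (h : ∀ X ∈ T, X.charpoly = f) : SameTraces T := by
  intro X hX Y hY
  have e : X.charpoly = Y.charpoly := (h X hX).trans (h Y hY).symm
  exact ⟨⟨trace_eq_of_charpolyRev_eq (charpolyRev_eq_of_charpoly_eq e),
    trace_sq_eq_of_charpoly_eq e⟩, trace_cube_eq_of_charpoly_eq e,
    trace_pow_four_eq_of_charpoly_eq e⟩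

lemma FinRank.exists_le_divHull {G : Type*} [CommGroup G] {Γ : Subgroup G} {ρ : ℕ}
    (h : FinRank Γ ρ) : ∃ S : Fin ρ → G, Γ ≤ divHull S := by
  obtain ⟨S, hS, -, hΓ⟩ := h
  refine ⟨fun i => ((S.equivFinOfCardEq hS).symm i : G), fun x hx => ?_⟩
  obtain ⟨k, hk, hxk⟩ := hΓ x hx
  refine mem_divHull.2 ⟨k, hk, ?_⟩
  convert hxk
  ext y
  constructor
  · rintro ⟨i, rfl⟩
    exact ((S.equivFinOfCardEq hS).symm i).2
  · intro hy
    exact ⟨S.equivFinOfCardEq hS ⟨y, hy⟩, by simp⟩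

end CountMatrices

theorem count_matrices_charpoly_refined (n ρ : ℕ) (hn : 3 ≤ n) :
    ∃ C : ℝ, 0 < C ∧ ∀ (K : Type*) [Field K] [CharZero K] (Γ : Subgroup Kˣ),
      FinRank Γ ρ →
      ∀ f : Polynomial K, f.Monic → f.natDegree = n →
      ∀ A : Finset K, (∀ a ∈ A, ∃ u : Kˣ, u ∈ Γ ∧ (u : K) = a) →
      ((f.coeff (n - 1) = 0 ∧ f.coeff (n - 2) = 0 →
          ({X : Matrix (Fin n) (Fin n) K | (∀ i j, X i j ∈ A) ∧ X.charpoly = f}.ncard : ℝ) ≤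
            C * (A.card : ℝ) ^ (betaExp n - lamExp n)) ∧
       (f.coeff (n - 1) = 0 ∧ f.coeff (n - 2) ≠ 0 →
          ({X : Matrix (Fin n) (Fin n) K | (∀ i j, X i j ∈ A) ∧ X.charpoly = f}.ncard : ℝ) ≤
            C * (A.card : ℝ) ^ (betaExp n - muExp n)) ∧
       (f.coeff (n - 1) ≠ 0 →
          ({X : Matrix (Fin n) (Fin n) K | (∀ i j, X i j ∈ A) ∧ X.charpoly = f}.ncard : ℝ) ≤
            C * (A.card : ℝ) ^ (betaExp n - nuExp n))) := by
  obtain ⟨C, hC, hbound⟩ := exists_card_le_of_three_le ρ hn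
  refine ⟨C + 1, by positivity, ?_⟩
  intro K _ _ Γ hΓ f _ _ A hA
  classical
  obtain ⟨S, hS⟩ := hΓ.exists_le_divHull
  have main : ∀ s : ℝ, s ≤ (if n ≤ 4 then 1 else 3 / 2) →
      ({X : Matrix (Fin n) (Fin n) K | (∀ i j, X i j ∈ A) ∧ X.charpoly = f}.ncard : ℝ) ≤
        (C + 1) * (A.card : ℝ) ^ (betaExp n - s) := by
    intro s hs
    obtain ⟨T, hmem⟩ : ∃ T : Finset (Matrix (Fin n) (Fin n) K),
        ∀ X, X ∈ T ↔ (∀ i j, X i j ∈ A) ∧ X.charpoly = f := by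
      have hfin : {X : Matrix (Fin n) (Fin n) K |
          (∀ i j, X i j ∈ A) ∧ X.charpoly = f}.Finite := by
        refine Set.Finite.subset (Set.Finite.pi' fun _ : Fin n => Set.Finite.pi' fun _ : Fin n =>
          A.finite_toSet) fun X hX => ?_
        exact hX.1
      exact ⟨hfin.toFinset, fun X => hfin.mem_toFinset⟩
    have hset : {X : Matrix (Fin n) (Fin n) K | (∀ i j, X i j ∈ A) ∧ X.charpoly = f} = T :=
      Set.ext fun X => (hmem X).symm
    rw [hset, Set.ncard_coe_finset]
    obtain rfl | hne := A.eq_empty_or_nonempty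
    · have hT0 : T = ∅ := Finset.eq_empty_of_forall_notMem fun X hX =>
        Finset.notMem_empty _ (((hmem X).1 hX).1 ⟨0, by omega⟩ ⟨0, by omega⟩)
      rw [hT0, Finset.card_empty, Nat.cast_zero]
      positivity
    have hA1 : (1 : ℝ) ≤ A.card := by exact_mod_cast hne.card_pos
    calc (T.card : ℝ) ≤ C * (A.card : ℝ) ^ (betaExp n - if n ≤ 4 then 1 else 3 / 2) :=
          hbound K S A (fun a ha => (hA a ha).imp fun u hu => ⟨hS hu.1, hu.2⟩) hne T
            (fun X hX => ((hmem X).1 hX).1) (sameTraces_of_charpoly_eq fun X hX => ((hmem X).1 hX).2)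
      _ ≤ (C + 1) * (A.card : ℝ) ^ (betaExp n - s) := by
          exact mul_le_mul (by linarith)
            (Real.rpow_le_rpow_of_exponent_le hA1 (by linarith)) (by positivity) (by linarith)
  refine ⟨fun _ => main _ ?_, fun _ => main _ ?_, fun _ => main _ ?_⟩
  · unfold lamExp
    split_ifs <;> first | omega | norm_num
  · unfold muExp
    split_ifs <;> norm_num
  · unfold nuExp
    split_ifs <;> first | omega | norm_num
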